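/- arXiv:2202.11554 — 6 statements merged into one kernel-verified Lean document; each statement's English description precedes it below -/
import Mathlib

section
/- Every edge-symmetric positive n-person shortest path game Γ=(G,v₀,ℓ) has a Nash equilibrium in pure stationary strategies. Moreover, it has a terminal Nash equilibrium (one whose play reaches a terminal) whenever some terminal position is reachable from the initial position v₀ in G. -/
open scoped Classical

section CoreDefs

variable {V : Type}

/-- A position is terminal iff it has no outgoing edges. -/
def Terminal (E : V → V → Prop) (v : V) : Prop := ∀ u, ¬ E v u

/-- A situation (profile of pure stationary strategies), encoded as a single
successor map: at every non-terminal position it must follow an edge. -/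
def IsSituation (E : V → V → Prop) (s : V → V) : Prop :=
  ∀ v, ¬ Terminal E v → E v (s v)

/-- `s'` is a unilateral deviation of player `i` from `s`: they agree at every
position not controlled by `i` (terminals are controlled by nobody). -/
def Deviation {n : ℕ} (E : V → V → Prop) (owner : V → Fin n) (i : Fin n)
    (s s' : V → V) : Prop :=
  ∀ v, (owner v ≠ i ∨ Terminal E v) → s' v = s v

/-- The play of `s` started at `v` reaches a terminal position. -/
def Reaches (E : V → V → Prop) (s : V → V) (v : V) : Prop :=
  ∃ k, Terminal E (s^[k] v)

/-- First time the play of `s` from `v` is at a terminal position. -/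
noncomputable def stopTime (E : V → V → Prop) (s : V → V) (v : V) : ℕ :=
  sInf {k | Terminal E (s^[k] v)}

/-- The terminal position reached by the play of `s` from `v` (junk if none). -/
noncomputable def playEnd (E : V → V → Prop) (s : V → V) (v : V) : V :=
  s^[stopTime E s v] v

/-- Effective cost in a terminal game: the cost of the terminal reached,
`0` for an infinite play. -/
noncomputable def tCost (E : V → V → Prop) (L : V → ℝ) (s : V → V) (v : V) : ℝ :=
  if Reaches E s v then L (playEnd E s v) else 0

/-- Effective cost in a positive shortest path game: the total length of the
play if it terminates, `+∞` for an infinite play. -/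
noncomputable def spCost (E : V → V → Prop) (l : V → V → ℝ) (s : V → V) (v : V) : EReal :=
  if Reaches E s v then
    (((Finset.range (stopTime E s v)).sum fun k => l (s^[k] v) (s^[k+1] v) : ℝ) : EReal)
  else ⊤

/-- Edge-symmetry: every move can be reversed, except moves entering terminals. -/
def EdgeSymm (E : V → V → Prop) : Prop :=
  ∀ u v, E u v → ¬ Terminal E v → E v u

end CoreDefs

section Levels

variable {V : Type} {n : ℕ}

/-- A move between two non-terminal positions of the same player. -/
def OwnStep (E : V → V → Prop) (owner : V → Fin n) (a b : V) : Prop :=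
  E a b ∧ ¬ Terminal E b ∧ owner b = owner a

/-- A terminal can be reached from `v` by leaving exactly `d` blocks of consecutive positions
having the same owner. -/
def ReachWithin (E : V → V → Prop) (owner : V → Fin n) : ℕ → V → Prop
  | 0, v => Terminal E v
  | d + 1, v => ∃ x u, Relation.ReflTransGen (OwnStep E owner) v x ∧ E x u ∧
      ReachWithin E owner d u

/-- The least number of blocks that have to be left to reach a terminal (`0` if impossible). -/
noncomputable def level (E : V → V → Prop) (owner : V → Fin n) (v : V) : ℕ :=
  sInf {d | ReachWithin E owner d v}

/-- Some terminal can be reached from `v`. -/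
def CanTerminate (E : V → V → Prop) (owner : V → Fin n) (v : V) : Prop :=
  ∃ d, ReachWithin E owner d v

variable {E : V → V → Prop} {owner : V → Fin n}

lemma not_terminal_of_edge {v u : V} (h : E v u) : ¬ Terminal E v := fun ht => ht u h

lemma CanTerminate.reachWithin_level {v : V} (h : CanTerminate E owner v) :
    ReachWithin E owner (level E owner v) v := Nat.sInf_mem h

lemma level_le {v : V} {d : ℕ} (h : ReachWithin E owner d v) : level E owner v ≤ d :=
  Nat.sInf_le h

lemma canTerminate_of_terminal {v : V} (h : Terminal E v) : CanTerminate E owner v := ⟨0, h⟩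

lemma level_of_terminal {v : V} (h : Terminal E v) : level E owner v = 0 :=
  Nat.le_zero.1 (level_le (d := 0) h)

lemma CanTerminate.level_pos {v : V} (h : CanTerminate E owner v) (hv : ¬ Terminal E v) :
    0 < level E owner v := by
  rcases Nat.eq_zero_or_pos (level E owner v) with h0 | h0
  · have := h.reachWithin_level
    rw [h0] at this
    exact absurd this hv
  · exact h0

lemma CanTerminate.of_edge {v u : V} (hu : CanTerminate E owner u) (h : E v u) :
    CanTerminate E owner v :=
  ⟨level E owner u + 1, v, u, .refl, h, hu.reachWithin_level⟩

lemma CanTerminate.level_le_succ {v u : V} (hu : CanTerminate E owner u) (h : E v u) :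
    level E owner v ≤ level E owner u + 1 :=
  level_le ⟨v, u, .refl, h, hu.reachWithin_level⟩

lemma canTerminate_of_reflTransGen {v t : V} (ht : Terminal E t)
    (h : Relation.ReflTransGen E v t) : CanTerminate E owner v := by
  induction h using Relation.ReflTransGen.head_induction_on with
  | refl => exact canTerminate_of_terminal ht
  | head h _ ih => exact ih.of_edge h

lemma OwnStep.symm (hsym : EdgeSymm E) {v u : V} (h : OwnStep E owner v u) :
    OwnStep E owner u v :=
  ⟨hsym _ _ h.1 h.2.1, not_terminal_of_edge h.1, h.2.2.symm⟩

lemma reflTransGen_ownStep_symm (hsym : EdgeSymm E) {v u : V}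
    (h : Relation.ReflTransGen (OwnStep E owner) v u) :
    Relation.ReflTransGen (OwnStep E owner) u v := by
  induction h with
  | refl => exact .refl
  | tail _ h ih => exact .head (h.symm hsym) ih

lemma OwnStep.reachWithin {v u : V} (h : OwnStep E owner v u) {d : ℕ}
    (hu : ReachWithin E owner d u) : ReachWithin E owner d v := by
  cases d with
  | zero => exact absurd hu h.2.1
  | succ d =>
    obtain ⟨x, w, hx, hw⟩ := hu
    exact ⟨x, w, .head h hx, hw⟩

lemma OwnStep.reachWithin_iff (hsym : EdgeSymm E) {v u : V} (h : OwnStep E owner v u) (d : ℕ) :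
    ReachWithin E owner d u ↔ ReachWithin E owner d v :=
  ⟨h.reachWithin, (h.symm hsym).reachWithin⟩

lemma OwnStep.level_eq (hsym : EdgeSymm E) {v u : V} (h : OwnStep E owner v u) :
    level E owner u = level E owner v := by
  simp only [level, h.reachWithin_iff hsym]

lemma CanTerminate.exists_exit {v : V} {d : ℕ} (h : CanTerminate E owner v)
    (hd : level E owner v = d + 1) :
    ∃ x u, Relation.ReflTransGen (OwnStep E owner) v x ∧ E x u ∧ CanTerminate E owner u ∧
      level E owner u = d := by
  have hr := h.reachWithin_level
  rw [hd] at hr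
  obtain ⟨x, u, hx, hxu, hu⟩ := hr
  have hc : CanTerminate E owner u := ⟨d, hu⟩
  have h1 : level E owner v ≤ level E owner u + 1 := level_le ⟨x, u, hx, hxu, hc.reachWithin_level⟩
  exact ⟨x, u, hx, hxu, hc, le_antisymm (level_le hu) (by omega)⟩

lemma block_properties (hsym : EdgeSymm E) {y v : V}
    (hy : CanTerminate E owner y) (hyt : ¬ Terminal E y)
    (h : Relation.ReflTransGen (OwnStep E owner) y v) :
    CanTerminate E owner v ∧ ¬ Terminal E v ∧ level E owner v = level E owner y ∧
      owner v = owner y := by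
  induction h with
  | refl => exact ⟨hy, hyt, rfl, rfl⟩
  | tail _ h ih =>
    exact ⟨ih.1.imp fun d hd => (h.symm hsym).reachWithin hd, h.2.1,
      (h.level_eq hsym).trans ih.2.2.1, h.2.2.trans ih.2.2.2⟩

end Levels

section ShortestPath

variable {V : Type}

/-- `r` is the length of a walk inside `C` from `v`, followed by a move into `Q`, where a
final cost `g` is paid. -/
inductive ExitWalk (E : V → V → Prop) (C Q : Set V) (l : V → V → ℝ) (g : V → ℝ) : V → ℝ → Prop
  | leave {v u : V} : v ∈ C → u ∈ Q → E v u → ExitWalk E C Q l g v (l v u + g u)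
  | step {v u : V} {r : ℝ} : v ∈ C → u ∈ C → E v u → ExitWalk E C Q l g u r →
      ExitWalk E C Q l g v (l v u + r)

/-- Solution of the one-player shortest path problem of leaving `C` into `Q`. -/
lemma exists_exit_potential [Fintype V] (E : V → V → Prop) (C Q : Set V) (l : V → V → ℝ)
    (g : V → ℝ) (hl : ∀ u v, E u v → 0 < l u v) (hg : ∀ u ∈ Q, 0 ≤ g u)
    (hne : ∀ v ∈ C, ∃ r, ExitWalk E C Q l g v r) :
    ∃ p : V → ℝ,
      (∀ v ∈ C, ∀ u ∈ C, E v u → p v ≤ l v u + p u) ∧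
      (∀ v ∈ C, ∀ u ∈ Q, E v u → p v ≤ l v u + g u) ∧
      (∀ v ∈ C, ∃ u, E v u ∧ (u ∈ C ∧ p v = l v u + p u ∨ u ∈ Q ∧ p v = l v u + g u)) := by
  have hpos : ∀ v r, ExitWalk E C Q l g v r → 0 ≤ r := by
    intro v r h
    induction h with
    | leave _ hu hE => exact add_nonneg (hl _ _ hE).le (hg _ hu)
    | step _ _ hE _ ih => exact add_nonneg (hl _ _ hE).le ih
  let p : V → ℝ := fun v => sInf {r | ExitWalk E C Q l g v r}
  have hle : ∀ v r, ExitWalk E C Q l g v r → p v ≤ r := fun v r h =>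
    csInf_le ⟨0, fun r hr => hpos v r hr⟩ h
  have hstep : ∀ v ∈ C, ∀ u ∈ C, E v u → p v ≤ l v u + p u := by
    intro v hv u hu hE
    have : p v - l v u ≤ p u := le_csInf (hne u hu) fun r hr => by
      have := hle v _ (.step hv hu hE hr)
      linarith
    linarith
  have hleave : ∀ v ∈ C, ∀ u ∈ Q, E v u → p v ≤ l v u + g u := fun v hv u hu hE =>
    hle v _ (.leave hv hu hE)
  refine ⟨p, hstep, hleave, ?_⟩
  intro v hv
  let O : Set (V × ℝ) := {w | E v w.1 ∧ (w.1 ∈ C ∧ w.2 = l v w.1 + p w.1 ∨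
    w.1 ∈ Q ∧ w.2 = l v w.1 + g w.1)}
  have hfin : O.Finite := by
    refine ((Set.finite_range fun u => (u, l v u + p u)).union
      (Set.finite_range fun u => (u, l v u + g u))).subset ?_
    rintro ⟨u, r⟩ ⟨_, ⟨_, h⟩ | ⟨_, h⟩⟩
    · exact .inl ⟨u, Prod.ext rfl h.symm⟩
    · exact .inr ⟨u, Prod.ext rfl h.symm⟩
  have hfirst : ∀ r, ExitWalk E C Q l g v r → ∃ w ∈ O, w.2 ≤ r := by
    rintro _ (⟨_, hu, hE⟩ | ⟨_, hu, hE, hr⟩)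
    · exact ⟨(_, _), ⟨hE, .inr ⟨hu, rfl⟩⟩, le_rfl⟩
    · exact ⟨(_, l v _ + p _), ⟨hE, .inl ⟨hu, rfl⟩⟩, add_le_add_right (hle _ _ hr) _⟩
  obtain ⟨r0, hr0⟩ := hne v hv
  obtain ⟨w0, hw0, -⟩ := hfirst r0 hr0
  obtain ⟨w, hw, hmin⟩ := Set.exists_min_image O Prod.snd hfin ⟨w0, hw0⟩
  have hge : w.2 ≤ p v := le_csInf (hne v hv) fun r hr => by
    obtain ⟨w', hw', h⟩ := hfirst r hr
    exact (hmin w' hw').trans h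
  obtain ⟨hE, ⟨hu, h⟩ | ⟨hu, h⟩⟩ := hw
  · exact ⟨w.1, hE, .inl ⟨hu, le_antisymm (hstep v hv _ hu hE) (h ▸ hge)⟩⟩
  · exact ⟨w.1, hE, .inr ⟨hu, le_antisymm (hleave v hv _ hu hE) (h ▸ hge)⟩⟩

/-- Following a potential from `v` yields a path in `C` with a single exit `e` into `Q`, along
which the remaining costs `c` of all players are computed. -/
lemma exists_exit_path [Fintype V] {ι : Type} (E : V → V → Prop) (C Q : Set V)
    (l : ι → V → V → ℝ) (i : ι) (f' : V → V) (c' : ι → V → ℝ) (p : V → ℝ)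
    (hl : ∀ i u v, E u v → 0 < l i u v) (hc : ∀ j, ∀ u ∈ Q, 0 ≤ c' j u)
    (hCQ : ∀ u ∈ Q, u ∉ C)
    (hp : ∀ v ∈ C, ∃ u, E v u ∧
      (u ∈ C ∧ p v = l i v u + p u ∨ u ∈ Q ∧ p v = l i v u + c' i u)) :
    ∀ v ∈ C, ∃ (S : Set V) (f : V → V) (c : ι → V → ℝ) (e : V),
      v ∈ S ∧ S ⊆ C ∧ e ∈ Q ∧
      (∀ x ∈ S, p x ≤ p v ∧ E x (f x) ∧ (f x ∈ S ∨ f x = e) ∧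
        (∀ j, 0 ≤ c j x ∧ c j x = l j x (f x) + c j (f x)) ∧ c i x = p x) ∧
      (∀ x, x ∉ C → f x = f' x ∧ ∀ j, c j x = c' j x) := by
  have hwf : WellFounded (fun a b : V => p a < p b) := by
    have : IsTrans V (fun a b : V => p a < p b) := ⟨fun _ _ _ => lt_trans⟩
    have : Std.Irrefl (fun a b : V => p a < p b) := ⟨fun _ => lt_irrefl _⟩
    exact Finite.wellFounded_of_trans_of_irrefl _
  intro v
  induction v using hwf.induction with
  | _ v ih =>
  intro hv
  obtain ⟨u, hE, ⟨hu, hpu⟩ | ⟨hu, hpu⟩⟩ := hp v hv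
  · have hlt : p u < p v := by have := hl i _ _ hE; linarith
    obtain ⟨S, f, c, e, huS, hSC, he, hS, hout⟩ := ih u hlt hu
    have hvS : v ∉ S := fun h => by have := (hS v h).1; linarith
    have hne : ∀ x ∈ S, x ≠ v := fun x hx h => hvS (h ▸ hx)
    have hev : e ≠ v := fun h => hCQ e he (h ▸ hv)
    refine ⟨insert v S, Function.update f v u,
      fun j => Function.update (c j) v (l j v u + c j u), e, Set.mem_insert _ _,
      Set.insert_subset hv hSC, he, ?_, ?_⟩
    · rintro x (rfl | hx)
      · refine ⟨le_rfl, by simpa using hE, by simp [huS], fun j => ?_, ?_⟩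
        · have h1 := ((hS u huS).2.2.2.1 j).1
          have h2 := hl j _ _ hE
          simp only [Function.update_self, Function.update_of_ne (hne u huS)]
          exact ⟨by linarith, trivial⟩
        · simp [(hS u huS).2.2.2.2, hpu]
      · obtain ⟨h1, h2, h3, h4, h5⟩ := hS x hx
        have hfx : f x ≠ v := by
          rcases h3 with h | h
          · exact hne _ h
          · exact h ▸ hev
        simp only [Function.update_of_ne (hne x hx), Function.update_of_ne hfx]
        exact ⟨h1.trans hlt.le, h2, h3.imp (Set.mem_insert_of_mem _) id, h4, h5⟩
    · intro x hx
      have hxv : x ≠ v := fun h => hx (h ▸ hv)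
      simp only [Function.update_of_ne hxv]
      exact hout x hx
  · have huv : u ≠ v := fun h => hCQ u hu (h ▸ hv)
    refine ⟨{v}, Function.update f' v u,
      fun j => Function.update (c' j) v (l j v u + c' j u), u, rfl,
      Set.singleton_subset_iff.2 hv, hu, ?_, ?_⟩
    · rintro x rfl
      refine ⟨le_rfl, by simpa using hE, by simp, fun j => ?_, by simp [hpu]⟩
      have h1 := hc j u hu
      have h2 := hl j _ _ hE
      simp only [Function.update_self, Function.update_of_ne huv]
      exact ⟨by linarith, trivial⟩
    · intro x hx
      have hxv : x ≠ v := fun h => hx (h ▸ hv)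
      simp [Function.update_of_ne hxv]

end ShortestPath

section Plans

variable {V : Type} {n : ℕ}

/-- A partial equilibrium plan. `U` is a union of blocks, at most one on each level; `Q` is the set
of planned positions (and terminals), where the move is `f` and the remaining costs are `c`; `p` is
the least cost to the owner of moving inside the block and then down into `Q`; `W k` is the value
of `p` at the position of level `k` where the plan enters that level. -/
structure IsPlan (E : V → V → Prop) (owner : V → Fin n) (l : Fin n → V → V → ℝ)
    (d : ℕ) (U Q : Set V) (f : V → V) (c : Fin n → V → ℝ) (p : V → ℝ) (W : ℕ → ℝ) : Prop where
  canTerminate : ∀ v ∈ U, CanTerminate E owner v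
  not_terminal : ∀ v ∈ U, ¬ Terminal E v
  level_le : ∀ v ∈ U, level E owner v ≤ d
  closed : ∀ v ∈ U, ∀ u, OwnStep E owner v u → u ∈ U
  owner_eq : ∀ v ∈ U, ∀ u ∈ U, level E owner v = level E owner u → owner v = owner u
  terminal_mem : ∀ t, Terminal E t → t ∈ Q
  mem_of_planned : ∀ v ∈ Q, ¬ Terminal E v → v ∈ U
  exists_ownStep : ∀ v ∈ U, v ∉ Q → ∃ u, OwnStep E owner v u
  edge : ∀ v ∈ Q, ¬ Terminal E v → E v (f v)
  next_mem : ∀ v ∈ Q, ¬ Terminal E v → f v ∈ Q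
  level_next : ∀ v ∈ Q, ¬ Terminal E v → level E owner (f v) ≤ level E owner v
  cost_eq : ∀ v ∈ Q, ¬ Terminal E v → ∀ i, c i v = l i v (f v) + c i (f v)
  potential_eq : ∀ v ∈ Q, ¬ Terminal E v → p v = c (owner v) v
  cost_terminal : ∀ t, Terminal E t → ∀ i, c i t = 0
  cost_nonneg : ∀ i, ∀ v ∈ Q, 0 ≤ c i v
  potential_step : ∀ v ∈ U, ∀ u, OwnStep E owner v u → p v ≤ l (owner v) v u + p u
  potential_leave : ∀ v ∈ U, ∀ u ∈ Q, E v u → level E owner u < level E owner v →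
    p v ≤ l (owner v) v u + c (owner v) u
  entry : ∀ v ∈ Q, ¬ Terminal E v → ¬ Terminal E (f v) →
    level E owner (f v) < level E owner v → p (f v) = W (level E owner (f v))

variable {E : V → V → Prop} {owner : V → Fin n} {l : Fin n → V → V → ℝ}

lemma IsPlan.level_le_of_mem {d : ℕ} {U Q : Set V} {f : V → V} {c : Fin n → V → ℝ} {p : V → ℝ}
    {W : ℕ → ℝ} (h : IsPlan E owner l d U Q f c p W) {v : V} (hv : v ∈ Q) :
    CanTerminate E owner v ∧ level E owner v ≤ d := by
  by_cases ht : Terminal E v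
  · exact ⟨canTerminate_of_terminal ht, by simp [level_of_terminal ht]⟩
  · exact ⟨h.canTerminate v (h.mem_of_planned v hv ht), h.level_le v (h.mem_of_planned v hv ht)⟩

/-- A plan whose entry value on the top level may be prescribed. -/
lemma IsPlan.update_top {d : ℕ} {U Q : Set V} {f : V → V} {c : Fin n → V → ℝ} {p : V → ℝ}
    {W : ℕ → ℝ} (h : IsPlan E owner l d U Q f c p W) (a : ℝ) :
    IsPlan E owner l d U Q f c p (Function.update W d a) :=
  { h with
    entry := fun v hv ht ht' hlt => by
      have := (h.level_le_of_mem hv).2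
      rw [Function.update_of_ne (by omega)]
      exact h.entry v hv ht ht' hlt }

theorem IsPlan.extend [Fintype V] (hsym : EdgeSymm E) (hpos : ∀ i u v, E u v → 0 < l i u v)
    {d : ℕ} {U Q : Set V} {f : V → V} {c : Fin n → V → ℝ} {p : V → ℝ} {W : ℕ → ℝ}
    (h : IsPlan E owner l d U Q f c p W) {y x u : V} (hy : CanTerminate E owner y)
    (hyd : level E owner y = d + 1) (hyx : Relation.ReflTransGen (OwnStep E owner) y x)
    (hxu : E x u) (hu : u ∈ Q) :
    ∃ U Q f c p W, IsPlan E owner l (d + 1) U Q f c p W ∧ y ∈ Q := by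
  have hyt : ¬ Terminal E y := fun ht => by simp [level_of_terminal ht] at hyd
  set C : Set V := {v | Relation.ReflTransGen (OwnStep E owner) y v} with hC
  have hblock : ∀ v ∈ C, CanTerminate E owner v ∧ ¬ Terminal E v ∧ level E owner v = d + 1 ∧
      owner v = owner y := fun v hv => by
    have := block_properties hsym hy hyt hv
    rwa [hyd] at this
  have hyC : y ∈ C := Relation.ReflTransGen.refl
  have hCstep : ∀ v ∈ C, ∀ w, OwnStep E owner v w → w ∈ C := fun v hv w hw =>
    Relation.ReflTransGen.tail hv hw
  have hUC : ∀ v ∈ U, v ∉ C := fun v hv hvC => by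
    have := h.level_le v hv
    have := (hblock v hvC).2.2.1
    omega
  have hQC : ∀ v ∈ Q, v ∉ C := fun v hv hvC => by
    have := (h.level_le_of_mem hv).2
    have := (hblock v hvC).2.2.1
    omega
  have hne : ∀ v ∈ C, ∃ r, ExitWalk E C Q (l (owner y)) (c (owner y)) v r := by
    intro v hv
    have hvx := (reflTransGen_ownStep_symm hsym hv).trans hyx
    induction hvx using Relation.ReflTransGen.head_induction_on with
    | refl => exact ⟨_, .leave hyx hu hxu⟩
    | head hs _ ih =>
      obtain ⟨r, hr⟩ := ih (hCstep _ hv _ hs)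
      exact ⟨_, .step hv (hCstep _ hv _ hs) hs.1 hr⟩
  obtain ⟨pC, hstep, hleave, hatt⟩ := exists_exit_potential E C Q (l (owner y)) (c (owner y))
    (hpos _) (h.cost_nonneg _) hne
  obtain ⟨S, f₁, c₁, e, hyS, hSC, heQ, hS, hout⟩ :=
    exists_exit_path E C Q l (owner y) f c pC hpos h.cost_nonneg hQC hatt y hyC
  have hfQ : ∀ v ∈ Q, f₁ v = f v := fun v hv => (hout v (hQC v hv)).1
  have hcQ : ∀ v ∈ Q, ∀ j, c₁ j v = c j v := fun v hv => (hout v (hQC v hv)).2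
  set q : V → ℝ := fun v => if v ∈ C then pC v else p v with hq
  have hqC : ∀ v ∈ C, q v = pC v := fun v hv => if_pos hv
  have hqU : ∀ v ∈ U, q v = p v := fun v hv => if_neg (hUC v hv)
  refine ⟨C ∪ U, S ∪ Q, f₁, c₁, q, Function.update W d (q e), ?_, .inl hyS⟩
  constructor
  · rintro v (hv | hv)
    exacts [(hblock v hv).1, h.canTerminate v hv]
  · rintro v (hv | hv)
    exacts [(hblock v hv).2.1, h.not_terminal v hv]
  · rintro v (hv | hv)
    exacts [(hblock v hv).2.2.1.le, (h.level_le v hv).trans (Nat.le_succ d)]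
  · rintro v (hv | hv) w hw
    exacts [.inl (hCstep v hv w hw), .inr (h.closed v hv w hw)]
  · rintro v (hv | hv) w (hw | hw) heq
    · rw [(hblock v hv).2.2.2, (hblock w hw).2.2.2]
    · have := h.level_le w hw
      have := (hblock v hv).2.2.1
      omega
    · have := h.level_le v hv
      have := (hblock w hw).2.2.1
      omega
    · exact h.owner_eq v hv w hw heq
  · exact fun t ht => .inr (h.terminal_mem t ht)
  · rintro v (hv | hv) ht
    exacts [.inl (hSC hv), .inr (h.mem_of_planned v hv ht)]
  · rintro v (hv | hv) hvQ
    · rcases Relation.ReflTransGen.cases_head (reflTransGen_ownStep_symm hsym hv) with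
        rfl | ⟨w, hw, -⟩
      · exact absurd (.inl hyS) hvQ
      · exact ⟨w, hw⟩
    · exact h.exists_ownStep v hv fun hh => hvQ (.inr hh)
  · rintro v (hv | hv) ht
    · exact (hS v hv).2.1
    · rw [hfQ v hv]
      exact h.edge v hv ht
  · rintro v (hv | hv) ht
    · rcases (hS v hv).2.2.1 with h' | h'
      exacts [.inl h', .inr (h' ▸ heQ)]
    · rw [hfQ v hv]
      exact .inr (h.next_mem v hv ht)
  · rintro v (hv | hv) ht
    · rw [(hblock v (hSC hv)).2.2.1]
      rcases (hS v hv).2.2.1 with h' | h'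
      · exact (hblock _ (hSC h')).2.2.1.le
      · rw [h']
        exact (h.level_le_of_mem heQ).2.trans (Nat.le_succ d)
    · rw [hfQ v hv]
      exact h.level_next v hv ht
  · rintro v (hv | hv) ht j
    · exact ((hS v hv).2.2.2.1 j).2
    · rw [hfQ v hv, hcQ v hv, hcQ _ (h.next_mem v hv ht)]
      exact h.cost_eq v hv ht j
  · rintro v (hv | hv) ht
    · rw [hqC v (hSC hv), (hblock v (hSC hv)).2.2.2]
      exact (hS v hv).2.2.2.2.symm
    · rw [hqU v (h.mem_of_planned v hv ht), hcQ v hv]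
      exact h.potential_eq v hv ht
  · intro t ht j
    rw [hcQ t (h.terminal_mem t ht)]
    exact h.cost_terminal t ht j
  · rintro j v (hv | hv)
    · exact ((hS v hv).2.2.2.1 j).1
    · rw [hcQ v hv]
      exact h.cost_nonneg j v hv
  · rintro v (hv | hv) w hw
    · have hwC := hCstep v hv w hw
      rw [hqC v hv, hqC w hwC, (hblock v hv).2.2.2]
      exact hstep v hv w hwC hw.1
    · rw [hqU v hv, hqU w (h.closed v hv w hw)]
      exact h.potential_step v hv w hw
  · rintro v (hv | hv) w (hw | hw) hE hlt
    · have := (hblock v hv).2.2.1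
      have := (hblock w (hSC hw)).2.2.1
      omega
    · rw [hqC v hv, hcQ w hw, (hblock v hv).2.2.2]
      exact hleave v hv w hw hE
    · have := h.level_le v hv
      have := (hblock w (hSC hw)).2.2.1
      omega
    · rw [hqU v hv, hcQ w hw]
      exact h.potential_leave v hv w hw hE hlt
  · rintro v (hv | hv) ht ht' hlt
    · have hvl := (hblock v (hSC hv)).2.2.1
      rcases (hS v hv).2.2.1 with h' | h'
      · have := (hblock _ (hSC h')).2.2.1
        omega
      · have h1 := (h.level_le_of_mem heQ).1.level_le_succ (h' ▸ (hS v hv).2.1)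
        have h2 := (h.level_le_of_mem heQ).2
        rw [h', show level E owner e = d by omega, Function.update_self]
    · rw [hfQ v hv] at ht' hlt ⊢
      have h1 := (h.level_le_of_mem hv).2
      rw [Function.update_of_ne (by omega),
        hqU _ (h.mem_of_planned _ (h.next_mem v hv ht) ht')]
      exact h.entry v hv ht ht' hlt

theorem exists_isPlan [Fintype V] (hsym : EdgeSymm E) (hpos : ∀ i u v, E u v → 0 < l i u v)
    (d : ℕ) : ∀ y, CanTerminate E owner y → level E owner y = d →
      ∃ U Q f c p W, IsPlan E owner l d U Q f c p W ∧ y ∈ Q := by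
  induction d with
  | zero =>
    intro y hy hyd
    have hyt : Terminal E y := by
      by_contra hyt
      have := hy.level_pos hyt
      omega
    refine ⟨∅, {t | Terminal E t}, id, fun _ _ => 0, fun _ => 0, fun _ => 0, ?_, hyt⟩
    constructor <;> simp +contextual
  | succ d ih =>
    intro y hy hyd
    obtain ⟨x, u, hyx, hxu, hu, hud⟩ := hy.exists_exit hyd
    obtain ⟨U, Q, f, c, p, W, h, huQ⟩ := ih u hu hud
    exact h.extend hsym hpos hy hyd hyx hxu huQ

end Plans

section Plays

variable {V : Type}

/-- The play of `s` from `v` stops after exactly `k` moves, with total length `r`. -/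
inductive PlayCost (E : V → V → Prop) (l : V → V → ℝ) (s : V → V) : V → ℕ → ℝ → Prop
  | halt {v : V} : Terminal E v → PlayCost E l s v 0 0
  | move {v : V} {k : ℕ} {r : ℝ} : ¬ Terminal E v → PlayCost E l s (s v) k r →
      PlayCost E l s v (k + 1) (l v (s v) + r)

variable {E : V → V → Prop} {l : V → V → ℝ} {s : V → V}

lemma PlayCost.stopTime_eq {v : V} {k : ℕ} {r : ℝ} (h : PlayCost E l s v k r) :
    Terminal E (s^[k] v) ∧ (∀ j < k, ¬ Terminal E (s^[j] v)) ∧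
      r = (Finset.range k).sum fun j => l (s^[j] v) (s^[j+1] v) := by
  induction h with
  | halt h => simpa using h
  | move hv _ ih =>
    refine ⟨ih.1, fun j hj => ?_, ?_⟩
    · cases j with
      | zero => exact hv
      | succ j => exact ih.2.1 j (by omega)
    · rw [Finset.sum_range_succ', add_comm, ih.2.2]
      rfl

lemma PlayCost.reaches {v : V} {k : ℕ} {r : ℝ} (h : PlayCost E l s v k r) : Reaches E s v :=
  ⟨k, h.stopTime_eq.1⟩

lemma PlayCost.spCost_eq {v : V} {k : ℕ} {r : ℝ} (h : PlayCost E l s v k r) :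
    spCost E l s v = (r : EReal) := by
  obtain ⟨h1, h2, h3⟩ := h.stopTime_eq
  have hk : stopTime E s v = k :=
    le_antisymm (Nat.sInf_le h1) (le_csInf ⟨k, h1⟩ fun j hj => not_lt.1 fun hlt => h2 j hlt hj)
  rw [spCost, if_pos h.reaches, hk, h3]

lemma Reaches.exists_playCost {v : V} (h : Reaches E s v) : ∃ k r, PlayCost E l s v k r := by
  obtain ⟨k, hk⟩ := h
  induction k generalizing v with
  | zero => exact ⟨_, _, .halt hk⟩
  | succ k ih =>
    by_cases hv : Terminal E v
    · exact ⟨_, _, .halt hv⟩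
    · obtain ⟨k, r, h⟩ := ih (v := s v) hk
      exact ⟨_, _, .move hv h⟩

lemma PlayCost.exists_reflTransGen (hs : IsSituation E s) {v : V} {k : ℕ} {r : ℝ}
    (h : PlayCost E l s v k r) : ∃ t, Terminal E t ∧ Relation.ReflTransGen E v t := by
  induction h with
  | halt h => exact ⟨_, h, .refl⟩
  | move hv _ ih =>
    obtain ⟨t, ht, hr⟩ := ih
    exact ⟨t, ht, .head (hs _ hv) hr⟩

end Plays

section Equilibrium

variable {V : Type} {n : ℕ} {E : V → V → Prop} {owner : V → Fin n} {l : Fin n → V → V → ℝ}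
  {d : ℕ} {U Q : Set V} {f : V → V} {c : Fin n → V → ℝ} {p : V → ℝ} {W : ℕ → ℝ}

/-- `s` follows the plan on `Q`; off `Q` it retreats to the neighbour in `U` of highest level,
and among those to one of highest potential. -/
def Follows (E : V → V → Prop) (owner : V → Fin n) (U Q : Set V) (f : V → V) (p : V → ℝ)
    (s : V → V) : Prop :=
  (∀ v ∈ Q, ¬ Terminal E v → s v = f v) ∧
  ∀ v, v ∉ Q → ∀ y ∈ U, E v y → s v ∈ U ∧ (level E owner y < level E owner (s v) ∨
    level E owner y = level E owner (s v) ∧ p y ≤ p (s v))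

lemma IsPlan.exists_follows [Fintype V] (h : IsPlan E owner l d U Q f c p W) :
    ∃ s, IsSituation E s ∧ Follows E owner U Q f p s := by
  have hex : ∀ v, ∃ u, (¬ Terminal E v → E v u) ∧ (v ∈ Q → ¬ Terminal E v → u = f v) ∧
      (v ∉ Q → ∀ y ∈ U, E v y → u ∈ U ∧ (level E owner y < level E owner u ∨
        level E owner y = level E owner u ∧ p y ≤ p u)) := by
    intro v
    by_cases ht : Terminal E v
    · exact ⟨v, fun h => absurd ht h, fun _ h => absurd ht h,
        fun _ y _ hE => absurd hE (ht y)⟩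
    by_cases hv : v ∈ Q
    · exact ⟨f v, fun _ => h.edge v hv ht, fun _ _ => rfl, fun h => absurd hv h⟩
    by_cases hU : ∃ y ∈ U, E v y
    · obtain ⟨y, hy, hE⟩ := hU
      obtain ⟨u, hu, hmax⟩ := Set.exists_max_image {y | y ∈ U ∧ E v y}
        (fun y => toLex (level E owner y, p y)) (Set.toFinite _) ⟨y, hy, hE⟩
      refine ⟨u, fun _ => hu.2, fun h => absurd h hv, fun _ w hw hEw => ⟨hu.1, ?_⟩⟩
      simpa [Prod.Lex.toLex_le_toLex] using hmax w ⟨hw, hEw⟩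
    · simp only [Terminal, not_forall, not_not] at ht
      obtain ⟨u, hu⟩ := ht
      exact ⟨u, fun _ => hu, fun h => absurd h hv, fun _ y hy hE => absurd ⟨y, hy, hE⟩ hU⟩
  choose s hs using hex
  exact ⟨s, fun v => (hs v).1, fun v => (hs v).2.1, fun v => (hs v).2.2⟩

lemma IsPlan.exists_playCost [Fintype V] (hpos : ∀ i u v, E u v → 0 < l i u v)
    (h : IsPlan E owner l d U Q f c p W) {s : V → V} (hs : Follows E owner U Q f p s)
    (i : Fin n) : ∀ v ∈ Q, ∃ k, PlayCost E (l i) s v k (c i v) := by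
  have hwf : WellFounded (fun a b : V => c i a < c i b) := by
    have : IsTrans V (fun a b : V => c i a < c i b) := ⟨fun _ _ _ => lt_trans⟩
    have : Std.Irrefl (fun a b : V => c i a < c i b) := ⟨fun _ => lt_irrefl _⟩
    exact Finite.wellFounded_of_trans_of_irrefl _
  intro v
  induction v using hwf.induction with
  | _ v ih =>
  intro hv
  by_cases ht : Terminal E v
  · exact ⟨0, h.cost_terminal v ht i ▸ .halt ht⟩
  · have hc := h.cost_eq v hv ht i
    have hl := hpos i _ _ (h.edge v hv ht)
    obtain ⟨k, hk⟩ := ih (f v) (by linarith) (h.next_mem v hv ht)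
    rw [← hs.1 v hv ht] at hk hc
    exact ⟨k + 1, hc ▸ .move ht hk⟩

/-- Lower bounds for the costs player `i` can achieve by deviating from `s`. -/
lemma IsPlan.le_playCost (hsym : EdgeSymm E) (hpos : ∀ i u v, E u v → 0 < l i u v)
    (h : IsPlan E owner l d U Q f c p W) {s s' : V → V} (hs : Follows E owner U Q f p s)
    (hs' : IsSituation E s') {i : Fin n} (hdev : ∀ v, owner v ≠ i → s' v = s v) (k : ℕ) :
    ∀ v r, PlayCost E (l i) s' v k r →
      (v ∈ Q → (Terminal E v ∨ owner v ≠ i) → c i v ≤ r) ∧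
      (v ∈ U → owner v = i → p v ≤ r ∨ W (level E owner v) ≤ r) ∧
      (v ∈ U → ∀ x ∈ U, owner x = i → level E owner x < level E owner v →
        W (level E owner x) ≤ r) := by
  induction k using Nat.strong_induction_on with
  | _ k ih =>
  intro v r hplay
  cases hplay with
  | halt ht =>
    exact ⟨fun _ _ => (h.cost_terminal v ht i).le, fun hv => absurd ht (h.not_terminal v hv),
      fun hv => absurd ht (h.not_terminal v hv)⟩
  | @move _ k r ht hplay =>
  have hE : E v (s' v) := hs' v ht
  have hl := hpos i _ _ hE
  obtain ⟨ihA, ihB, ihC⟩ := ih k (Nat.lt_succ_self k) _ _ hplay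
  have hlevel : s' v ∈ U → level E owner v ≤ level E owner (s' v) + 1 := fun hu =>
    (h.canTerminate _ hu).level_le_succ hE
  have hlevel_term : v ∈ U → Terminal E (s' v) → level E owner v = 1 := fun hv hu => by
    have h1 := (canTerminate_of_terminal (owner := owner) hu).level_le_succ hE
    have h2 := (h.canTerminate v hv).level_pos ht
    rw [level_of_terminal hu] at h1
    omega
  -- a move to a position off the plan owned by an opponent is answered by a retreat
  have hretreat : v ∈ U → ¬ Terminal E (s' v) → owner (s' v) ≠ i → s' v ∉ Q →
      ∃ z ∈ U, (level E owner v < level E owner z ∨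
        level E owner v = level E owner z ∧ p v ≤ p z) ∧
      ∃ k' < k + 1, ∃ r' ≤ r, PlayCost E (l i) s' z k' r' := by
    intro hv hu ho hQ
    have hsu := hs.2 _ hQ v hv (hsym _ _ hE hu)
    rw [← hdev _ ho] at hsu
    refine ⟨s' (s' v), hsu.1, hsu.2, ?_⟩
    cases hplay with
    | halt hu' => exact absurd hu' hu
    | @move _ k r hu hplay =>
      have hl' := hpos i _ _ (hs' _ hu)
      exact ⟨k, by omega, r, by linarith, hplay⟩
  refine ⟨fun hv ho => ?_, fun hv ho => ?_, fun hv x hx hxo hlt => ?_⟩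
  · replace ho := ho.resolve_left ht
    have hsv : s' v = f v := (hdev v ho).trans (hs.1 v hv ht)
    have hQ := h.next_mem v hv ht
    have hvU := h.mem_of_planned v hv ht
    rw [h.cost_eq v hv ht i]
    rw [hsv] at ihA ihB ⊢
    suffices c i (f v) ≤ r by linarith
    by_cases hu : Terminal E (f v) ∨ owner (f v) ≠ i
    · exact ihA hQ hu
    · push Not at hu
      have huU := h.mem_of_planned _ hQ hu.1
      have hne : level E owner (f v) ≠ level E owner v := fun heq =>
        ho ((h.owner_eq _ huU v hvU heq).symm.trans hu.2)
      have hentry := h.entry v hv ht hu.1 (lt_of_le_of_ne (h.level_next v hv ht) hne)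
      have hpe := h.potential_eq _ hQ hu.1
      rw [hu.2] at hpe
      have := ihB huU hu.2
      rw [← hentry, or_self, hpe] at this
      exact this
  · by_cases hu : Terminal E (s' v)
    · have hQ := h.terminal_mem _ hu
      have h1 := h.potential_leave v hv _ hQ hE (by
        rw [level_of_terminal hu]
        exact (h.canTerminate v hv).level_pos ht)
      have h2 := ihA hQ (.inl hu)
      rw [ho] at h1
      exact .inl (by linarith)
    by_cases huo : owner (s' v) = i
    · have hst : OwnStep E owner v (s' v) := ⟨hE, hu, huo.trans ho.symm⟩
      have h1 := h.potential_step v hv _ hst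
      rw [ho] at h1
      have h2 := ihB (h.closed v hv _ hst) huo
      rw [hst.level_eq hsym] at h2
      exact h2.imp (fun _ => by linarith) fun _ => by linarith
    by_cases hQ : s' v ∈ Q
    · have huU := h.mem_of_planned _ hQ hu
      rcases lt_trichotomy (level E owner (s' v)) (level E owner v) with hlt | heq | hlt
      · have h1 := h.potential_leave v hv _ hQ hE hlt
        have h2 := ihA hQ (.inr huo)
        rw [ho] at h1
        exact .inl (by linarith)
      · exact absurd ((h.owner_eq _ huU v hv heq).trans ho) huo
      · have := ihC huU v hv ho hlt
        exact .inr (by linarith)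
    · obtain ⟨z, hz, hvz, k', hk', r', hr', hplay'⟩ := hretreat hv hu huo hQ
      obtain ⟨-, ihB', ihC'⟩ := ih k' hk' _ _ hplay'
      rcases hvz with hlt | ⟨heq, hp⟩
      · have := ihC' hz v hv ho hlt
        exact .inr (by linarith)
      · have := ihB' hz ((h.owner_eq v hv z hz heq).symm.trans ho)
        rw [← heq] at this
        exact this.imp (fun _ => by linarith) fun _ => by linarith
  · have hxpos := (h.canTerminate x hx).level_pos (h.not_terminal x hx)
    have hu : ¬ Terminal E (s' v) := fun hu => by
      have := hlevel_term hv hu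
      omega
    suffices hsuff : W (level E owner x) ≤ r by linarith
    by_cases ho : owner v = i
    · by_cases huo : owner (s' v) = i
      · have hst : OwnStep E owner v (s' v) := ⟨hE, hu, huo.trans ho.symm⟩
        exact ihC (h.closed v hv _ hst) x hx hxo (by rwa [hst.level_eq hsym])
      by_cases hQ : s' v ∈ Q
      · have huU := h.mem_of_planned _ hQ hu
        have hne : level E owner (s' v) ≠ level E owner x := fun heq =>
          huo ((h.owner_eq _ huU x hx heq).trans hxo)
        have := hlevel huU
        exact ihC huU x hx hxo (by omega)
      · obtain ⟨z, hz, hvz, k', hk', r', hr', hplay'⟩ := hretreat hv hu huo hQ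
        exact ((ih k' hk' _ _ hplay').2.2 hz x hx hxo (by omega)).trans hr'
    · by_cases hQ : v ∈ Q
      · have hsv : s' v = f v := (hdev v ho).trans (hs.1 v hQ ht)
        have huQ : s' v ∈ Q := hsv ▸ h.next_mem v hQ ht
        have huU := h.mem_of_planned _ huQ hu
        have hle := hlevel huU
        by_cases heq : level E owner (s' v) = level E owner x
        · have hentry := h.entry v hQ ht (hsv ▸ hu) (by rw [← hsv]; omega)
          rw [← hsv] at hentry
          have := ihB huU ((h.owner_eq _ huU x hx heq).trans hxo)
          rw [← hentry, or_self, hentry, heq] at this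
          exact this
        · exact ihC huU x hx hxo (by omega)
      · obtain ⟨w, hw⟩ := h.exists_ownStep v hv hQ
        have hsv := hs.2 v hQ w (h.closed v hv w hw) hw.1
        rw [← hdev v ho, hw.level_eq hsym] at hsv
        exact ihC hsv.1 x hx hxo (by omega)

theorem exists_terminal_equilibrium [Fintype V] (hsym : EdgeSymm E)
    (hpos : ∀ i u v, E u v → 0 < l i u v) {v₀ : V} (hv₀ : ¬ Terminal E v₀)
    (hc : CanTerminate E owner v₀) :
    ∃ s, (IsSituation E s ∧
      ∀ i s', IsSituation E s' → Deviation E owner i s s' →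
        spCost E (l i) s v₀ ≤ spCost E (l i) s' v₀) ∧ Reaches E s v₀ := by
  obtain ⟨U, Q, f, c, p, W, h, hQ⟩ := exists_isPlan (l := l) hsym hpos _ v₀ hc rfl
  replace h := h.update_top (p v₀)
  obtain ⟨s, hs, hfol⟩ := h.exists_follows
  refine ⟨s, ⟨hs, fun i s' hs' hdev => ?_⟩,
    (h.exists_playCost hpos hfol (owner v₀) v₀ hQ).choose_spec.reaches⟩
  rw [(h.exists_playCost hpos hfol i v₀ hQ).choose_spec.spCost_eq]
  by_cases hr : Reaches E s' v₀
  · obtain ⟨k, r, hk⟩ := hr.exists_playCost (l := l i)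
    rw [hk.spCost_eq, EReal.coe_le_coe_iff]
    obtain ⟨hA, hB, -⟩ :=
      h.le_playCost hsym hpos hfol hs' (fun v hv => hdev v (.inl hv)) k v₀ r hk
    by_cases ho : owner v₀ = i
    · have := hB (h.mem_of_planned v₀ hQ hv₀) ho
      rwa [Function.update_self, or_self, h.potential_eq v₀ hQ hv₀, ho] at this
    · exact hA hQ (.inr ho)
  · rw [spCost, if_neg hr]
    exact le_top

end Equilibrium

/-- Every edge-symmetric positive `n`-person shortest path
game `Γ = (G, v₀, ℓ)` has a Nash equilibrium in pure stationary strategies;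
moreover it has a terminal Nash equilibrium whenever some terminal position is
reachable from the initial position `v₀`. -/
theorem edgeSymmetric_positive_shortestPathGame_has_NE
    {V : Type} [Fintype V] {n : ℕ}
    (E : V → V → Prop) (owner : V → Fin n) (l : Fin n → V → V → ℝ) (v0 : V)
    (hT : ∃ v, Terminal E v)        -- the set of terminals is nonempty
    (hv0 : ¬ Terminal E v0)         -- the initial position is not terminal
    (hsym : EdgeSymm E)             -- the game is edge-symmetric
    (hpos : ∀ i u v, E u v → 0 < l i u v)  -- all lengths are positive
    :
    (∃ s, IsSituation E s ∧
      ∀ i s', IsSituation E s' → Deviation E owner i s s' →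
        spCost E (l i) s v0 ≤ spCost E (l i) s' v0) ∧
    ((∃ t, Terminal E t ∧ Relation.ReflTransGen E v0 t) →
      ∃ s, (IsSituation E s ∧
        ∀ i s', IsSituation E s' → Deviation E owner i s s' →
          spCost E (l i) s v0 ≤ spCost E (l i) s' v0) ∧
        Reaches E s v0) := by
  have hterm : (∃ t, Terminal E t ∧ Relation.ReflTransGen E v0 t) →
      ∃ s, (IsSituation E s ∧
        ∀ i s', IsSituation E s' → Deviation E owner i s s' →
          spCost E (l i) s v0 ≤ spCost E (l i) s' v0) ∧
        Reaches E s v0 := fun ⟨_, ht, hr⟩ =>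
    exists_terminal_equilibrium hsym hpos hv0 (canTerminate_of_reflTransGen ht hr)
  refine ⟨?_, hterm⟩
  by_cases hr : ∃ t, Terminal E t ∧ Relation.ReflTransGen E v0 t
  · obtain ⟨s, hs, -⟩ := hterm hr
    exact ⟨s, hs⟩
  · have hex : ∀ v, ∃ u, ¬ Terminal E v → E v u := fun v => by
      by_cases hv : Terminal E v
      · exact ⟨v, fun h => absurd hv h⟩
      · simp only [Terminal, not_forall, not_not] at hv
        exact hv.imp fun u hu _ => hu
    choose s hs using hex
    refine ⟨s, hs, fun i s' hs' _ => ?_⟩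
    have hnr : ¬ Reaches E s' v0 := fun h => by
      obtain ⟨k, r, hk⟩ := h.exists_playCost (l := l i)
      exact hr (hk.exists_reflTransGen hs')
    rw [spCost, spCost, if_neg hnr]
    exact le_top
end

section
/- Let Γ=(G,v₀,𝓛) be a terminal game satisfying condition (CIW). Then there exist positive length functions ℓⁱ:E→ℝ (ℓⁱ(e)>0 for all i and e) such that, in the positive shortest path game Γ'=(G,v₀,ℓ) on the same graph and with the same partition of positions, every situation σ that is a terminal Nash equilibrium of Γ' is also a Nash equilibrium of Γ. -/
open scoped Classical

section Play

variable {V : Type} {E : V → V → Prop} {s : V → V} {v : V}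

theorem Reaches.terminal_playEnd (h : Reaches E s v) : Terminal E (playEnd E s v) :=
  Nat.sInf_mem (s := {k | Terminal E (s^[k] v)}) h

theorem not_terminal_iterate_of_lt_stopTime {k : ℕ} (hk : k < stopTime E s v) :
    ¬ Terminal E (s^[k] v) :=
  Nat.notMem_of_lt_sInf (s := {k | Terminal E (s^[k] v)}) hk

theorem Reaches.stopTime_pos (h : Reaches E s v) (hv : ¬ Terminal E v) :
    0 < stopTime E s v := by
  refine Nat.pos_of_ne_zero fun h0 => hv ?_
  simpa [playEnd, h0] using h.terminal_playEnd

/-- A terminating play visits no position twice before it stops. -/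
theorem Reaches.injOn_iterate (h : Reaches E s v) :
    Set.InjOn (fun k => s^[k] v) (Finset.range (stopTime E s v)) := by
  have key : ∀ a b, a < b → b < stopTime E s v → s^[a] v ≠ s^[b] v := by
    intro a b hab hb heq
    refine not_terminal_iterate_of_lt_stopTime (E := E) (s := s) (v := v)
      (k := stopTime E s v - b + a) (by omega) ?_
    rw [Function.iterate_add_apply, heq, ← Function.iterate_add_apply,
      Nat.sub_add_cancel hb.le]
    exact h.terminal_playEnd
  intro a ha b hb heq
  rw [Finset.mem_coe, Finset.mem_range] at ha hb
  rcases lt_trichotomy a b with hab | hab | hab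
  · exact absurd heq (key a b hab hb)
  · exact hab
  · exact absurd heq.symm (key b a hab ha)

theorem Reaches.stopTime_le_card [Fintype V] (h : Reaches E s v) :
    stopTime E s v ≤ Fintype.card V := by
  simpa using Finset.card_le_card_of_injOn (t := Finset.univ) _ (by simp) h.injOn_iterate

/-- Edges into a terminal `w` have length `M + L w`, all other edges have length `ε`. -/
noncomputable def terminalLength (E : V → V → Prop) (L : V → ℝ) (M ε : ℝ) (_ w : V) : ℝ :=
  if Terminal E w then M + L w else ε

theorem Reaches.spCost_terminalLength (h : Reaches E s v) (hv : ¬ Terminal E v)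
    (L : V → ℝ) (M ε : ℝ) :
    spCost E (terminalLength E L M ε) s v =
      (((stopTime E s v - 1 : ℕ) * ε + (M + L (playEnd E s v)) : ℝ) : EReal) := by
  obtain ⟨k, hk⟩ := Nat.exists_eq_succ_of_ne_zero (h.stopTime_pos hv).ne'
  have hend : playEnd E s v = s^[k + 1] v := by rw [playEnd, hk]
  have hterm : Terminal E (s^[k + 1] v) := hend ▸ h.terminal_playEnd
  rw [spCost, if_pos h, EReal.coe_eq_coe_iff, hk, Nat.succ_eq_add_one, Finset.sum_range_succ, hend]
  have hsum : ∀ j ∈ Finset.range k,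
      terminalLength E L M ε (s^[j] v) (s^[j + 1] v) = ε := fun j hj =>
    if_neg (not_terminal_iterate_of_lt_stopTime (by rw [hk]; simpa using hj))
  rw [Finset.sum_congr rfl hsum, terminalLength, if_pos hterm]
  simp

end Play

/-- The positive values of a finite family of reals are bounded away from zero. -/
theorem exists_pos_le_of_pos {ι : Type*} [Finite ι] (f : ι → ℝ) :
    ∃ δ > 0, ∀ i, 0 < f i → δ ≤ f i := by
  have h : ∀ᶠ δ in nhdsWithin (0 : ℝ) (Set.Ioi 0), ∀ i, 0 < f i → δ ≤ f i := by
    refine Filter.eventually_all.2 fun i => ?_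
    by_cases hi : 0 < f i
    · filter_upwards [Ioo_mem_nhdsGT hi] with δ hδ _ using hδ.2.le
    · exact Filter.Eventually.of_forall fun _ h => absurd h hi
  obtain ⟨δ, hδ, hpos⟩ := (h.and self_mem_nhdsWithin).exists
  exact ⟨δ, hpos, hδ⟩

/-- If `Γ = (G, v₀, 𝓛)` is a terminal game satisfying (CIW),
then there exist positive length functions `ℓⁱ : E → ℝ` such that in the
positive shortest path game `Γ' = (G, v₀, ℓ)` on the same graph (same players
and partition of positions) every situation that is a terminal Nash
equilibrium of `Γ'` is also a Nash equilibrium of `Γ`. -/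
theorem CIW_terminalGame_reduces_to_positive_shortestPathGame
    {V : Type} [Fintype V] {n : ℕ}
    (E : V → V → Prop) (owner : V → Fin n) (L : Fin n → V → ℝ) (v0 : V)
    (hT : ∃ v, Terminal E v)        -- the set of terminals is nonempty
    (hv0 : ¬ Terminal E v0)         -- the initial position is not terminal
    (hCIW : ∀ i w, Terminal E w → L i w < 0)  -- (CIW)
    :
    ∃ l : Fin n → V → V → ℝ,
      (∀ i u v, E u v → 0 < l i u v) ∧
      ∀ s, IsSituation E s →
        -- `s` is a terminal NE of the shortest path game `Γ'` …
        (∀ i s', IsSituation E s' → Deviation E owner i s s' →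
          spCost E (l i) s v0 ≤ spCost E (l i) s' v0) →
        Reaches E s v0 →
        -- … then `s` is a NE of the terminal game `Γ`.
        (∀ i s', IsSituation E s' → Deviation E owner i s s' →
          tCost E (L i) s v0 ≤ tCost E (L i) s' v0) := by
  obtain ⟨δ, hδ, hgap⟩ := exists_pos_le_of_pos
    fun p : Fin n × V × V => L p.1 p.2.1 - L p.1 p.2.2
  obtain ⟨M, hM⟩ : ∃ M, ∀ p : Fin n × V, -L p.1 p.2 < M :=
    (Filter.eventually_all.2 fun p => Filter.eventually_gt_atTop _).exists
  set N : ℝ := (Fintype.card V : ℝ)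
  have hN1 : 0 < N + 1 := by positivity
  set ε : ℝ := δ / (N + 1)
  have hε0 : 0 < ε := div_pos hδ hN1
  have hεN : (N + 1) * ε = δ := mul_div_cancel₀ δ hN1.ne'
  refine ⟨fun i => terminalLength E (L i) M ε, fun i u v _ => ?_, ?_⟩
  · dsimp only [terminalLength]
    split_ifs
    · linarith [hM (i, v)]
    · exact hε0
  intro s _ hNE hs i s' hs' hdev
  rw [tCost, if_pos hs, tCost]
  split_ifs with hr
  · have hle := hNE i s' hs' hdev
    rw [hs.spCost_terminalLength hv0, hr.spCost_terminalLength hv0,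
      EReal.coe_le_coe_iff] at hle
    by_contra! hlt
    have hδle := hgap (i, playEnd E s v0, playEnd E s' v0) (sub_pos.2 hlt)
    have hcard : ((stopTime E s' v0 - 1 : ℕ) : ℝ) ≤ N :=
      Nat.cast_le.2 ((Nat.sub_le _ _).trans hr.stopTime_le_card)
    have hmul := mul_le_mul_of_nonneg_right hcard hε0.le
    have hnonneg : 0 ≤ ((stopTime E s v0 - 1 : ℕ) : ℝ) * ε := by positivity
    simp only at hδle
    linarith
  · exact (hCIW i _ hs.terminal_playEnd).le
end

section
/- Let Γ=(G,v₀,ℓ) be an edge-symmetric positive n-person shortest path game in which all terminals are merged into a single terminal v_t and v_t is reachable from v₀. Then there exists a v₀→v_t path P satisfying both: (B) q(P) is minimal among all v₀→v_t paths, and (C) P is i-special for every player i∈I. -/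
open scoped Classical

section PathDefs

/-- A directed path from `a` to `b` in the graph with edge relation `R`,
given by its length and the sequence of visited vertices (no repeats). -/
structure DiPath {V : Type} (R : V → V → Prop) (a b : V) where
  len : ℕ
  f : ℕ → V
  first : f 0 = a
  last : f len = b
  step : ∀ k, k < len → R (f k) (f (k+1))
  inj : ∀ j k, j ≤ len → k ≤ len → f j = f k → j = k

variable {V : Type}

/-- One step inside the subgraph induced by the positions of a single player. -/
def CompStep {n : ℕ} (E : V → V → Prop) (owner : V → Fin n) (a b : V) : Prop :=
  E a b ∧ ¬ Terminal E a ∧ ¬ Terminal E b ∧ owner a = owner b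

/-- `u` and `v` lie in the same component: either `u = v` (this also covers the
terminal components) or `u` and `v` are mutually reachable inside the subgraph
induced by the positions of their common owner. -/
def SameComp {n : ℕ} (E : V → V → Prop) (owner : V → Fin n) (u v : V) : Prop :=
  u = v ∨ (Relation.ReflTransGen (CompStep E owner) u v ∧
           Relation.ReflTransGen (CompStep E owner) v u)

/-- `q(P)`: the number of maximal subpaths of `P` lying inside one component
(one more than the number of component changes along `P`). -/
noncomputable def qVal {n : ℕ} (E : V → V → Prop) (owner : V → Fin n) {a b : V}
    (P : DiPath E a b) : ℕ :=
  1 + Nat.card {k : ℕ // k < P.len ∧ ¬ SameComp E owner (P.f k) (P.f (k+1))}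

/-- Length of a path with respect to the length function `l`. -/
noncomputable def pathLen {V : Type} {R : V → V → Prop} {a b : V}
    (l : V → V → ℝ) (P : DiPath R a b) : ℝ :=
  (Finset.range P.len).sum fun k => l (P.f k) (P.f (k+1))

/-- `(x,y)` is an edge of the path `P`. -/
def onPath {R : V → V → Prop} {a b : V} (P : DiPath R a b) (x y : V) : Prop :=
  ∃ k, k < P.len ∧ P.f k = x ∧ P.f (k+1) = y

/-- Edge relation of the graph `G(i,P)`: edges of `P` together with all edges
leaving positions of player `i`. -/
def GiP {n : ℕ} (E : V → V → Prop) (owner : V → Fin n) (i : Fin n)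
    {a b : V} (P : DiPath E a b) (x y : V) : Prop :=
  onPath P x y ∨ (E x y ∧ owner x = i ∧ ¬ Terminal E x)

/-- `P` is `i`-special: `P` is a shortest `a → b` path in `G(i,P)` w.r.t. `lⁱ`. -/
def ISpecial {n : ℕ} (E : V → V → Prop) (owner : V → Fin n)
    (l : Fin n → V → V → ℝ) (i : Fin n) {a b : V} (P : DiPath E a b) : Prop :=
  ∀ Q : DiPath (GiP E owner i P) a b, pathLen (l i) P ≤ pathLen (l i) Q

end PathDefs

section Policy

variable {V ι : Type}

/-- A partial layered shortest path policy `s` with cost functions `c`, defined on `S`: the owner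
of each position moves optimally with respect to their own lengths, and no position outside `S` can
be reached more cheaply than the positions of the same layer and owner inside `S`. -/
structure PolicyOn (A : V → V → Prop) (o : V → ι) (d : V → ℕ) (l : ι → V → V → ℝ) (t : V)
    (S : Finset V) (s : V → V) (c : ι → V → ℝ) : Prop where
  target_mem : t ∈ S
  target_cost : ∀ i, c i t = 0
  step : ∀ x ∈ S, x ≠ t → A x (s x) ∧ s x ∈ S ∧ ∀ i, c i x = l i x (s x) + c i (s x)
  opt : ∀ x ∈ S, ∀ y ∈ S, A x y → c (o x) x ≤ l (o x) x y + c (o x) y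
  frontier : ∀ x ∈ S, ∀ y ∉ S, ∀ z ∈ S, A y z → d y = d x → o y = o x →
    c (o x) x ≤ l (o x) y z + c (o x) z
  closed : ∀ x ∈ S, ∀ y, Relation.ReflTransGen A y t → d y < d x → y ∈ S

/-- A path from outside `S` into `S` along which `d` is nonincreasing crosses the boundary. -/
lemma exists_boundary_edge {A : V → V → Prop} {d : V → ℕ} {t : V} {S : Finset V}
    (hA : ∀ x y, A x y → d y ≤ d x) (ht : t ∈ S) {x : V}
    (hx : Relation.ReflTransGen A x t) :
    x ∉ S → ∃ y z, y ∉ S ∧ z ∈ S ∧ A y z ∧ d y ≤ d x ∧ Relation.ReflTransGen A y t := by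
  induction hx using Relation.ReflTransGen.head_induction_on with
  | refl => exact fun h => absurd ht h
  | @head a b hab hbt ih =>
    intro ha
    by_cases hb : b ∈ S
    · exact ⟨a, b, ha, hb, hab, le_rfl, hbt.head hab⟩
    · obtain ⟨y, z, hy, hz, hyz, hd, hyt⟩ := ih hb
      exact ⟨y, z, hy, hz, hyz, hd.trans (hA _ _ hab), hyt⟩

lemma PolicyOn.extend [Fintype V] {A : V → V → Prop} {o : V → ι} {d : V → ℕ}
    {l : ι → V → V → ℝ} {t : V} (hpos : ∀ i x y, A x y → 0 < l i x y)
    (hA : ∀ x y, A x y → (d y = d x ∧ o y = o x) ∨ d y < d x)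
    {S : Finset V} {s : V → V} {c : ι → V → ℝ} (h : PolicyOn A o d l t S s c)
    {w : V} (hw : w ∉ S) (hwt : Relation.ReflTransGen A w t) :
    ∃ x ∉ S, ∃ s' c', PolicyOn A o d l t (insert x S) s' c' := by
  have hA' : ∀ x y, A x y → d y ≤ d x := fun x y hxy => by
    rcases hA x y hxy with h | h <;> omega
  obtain ⟨y₀, hy₀, hmin⟩ := Finset.exists_min_image
    (Finset.univ.filter fun y => y ∉ S ∧ Relation.ReflTransGen A y t) d ⟨w, by simp [hw, hwt]⟩
  simp only [Finset.mem_filter, Finset.mem_univ, true_and, and_imp] at hy₀ hmin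
  obtain ⟨y₁, z₁, hy₁, hz₁, hyz₁, hd₁, hr₁⟩ :=
    exists_boundary_edge hA' h.target_mem hy₀.2 hy₀.1
  obtain ⟨⟨x, z⟩, hxz, hkey⟩ := Finset.exists_min_image
    (Finset.univ.filter fun p : V × V => p.1 ∉ S ∧ p.2 ∈ S ∧ A p.1 p.2 ∧ d p.1 = d y₀)
    (fun p => l (o p.1) p.1 p.2 + c (o p.1) p.2)
    ⟨(y₁, z₁), by simp [hy₁, hz₁, hyz₁]; exact le_antisymm hd₁ (hmin _ hy₁ hr₁)⟩
  simp only [Finset.mem_filter, Finset.mem_univ, true_and, and_imp, Prod.forall] at hxz hkey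
  obtain ⟨hx, hz, hAxz, hdx⟩ := hxz
  have hlayer : ∀ y ∈ S, d y ≤ d x := fun y hy => by
    by_contra hlt
    exact hy₀.1 (h.closed y hy y₀ hy₀.2 (by omega))
  have hne : ∀ y ∈ S, y ≠ x := fun y hy e => hx (e ▸ hy)
  have hc : ∀ i, ∀ y ∈ S, Function.update (c i) x (l i x z + c i z) y = c i y :=
    fun i y hy => Function.update_of_ne (hne y hy) _ _
  refine ⟨x, hx, Function.update s x z, fun i => Function.update (c i) x (l i x z + c i z), ?_⟩
  constructor
  · exact Finset.mem_insert_of_mem h.target_mem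
  · intro i
    rw [hc i t h.target_mem, h.target_cost]
  · intro y hy hyt
    rcases Finset.mem_insert.1 hy with rfl | hy
    · simp only [Function.update_self]
      exact ⟨hAxz, Finset.mem_insert_of_mem hz, fun i => by rw [hc i z hz]⟩
    · obtain ⟨h1, h2, h3⟩ := h.step y hy hyt
      rw [Function.update_of_ne (hne y hy)]
      exact ⟨h1, Finset.mem_insert_of_mem h2, fun i => by rw [hc i y hy, hc i _ h2, h3]⟩
  · intro y hyI y' hyI' hyy
    rcases Finset.mem_insert.1 hyI with rfl | hy <;> rcases Finset.mem_insert.1 hyI' with rfl | hy'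
    · have := hpos (o y') y' y' hyy
      linarith
    · simp only [Function.update_self, hc _ y' hy']
      exact hkey y y' hx hy' hyy hdx
    · simp only [Function.update_self, hc _ y hy]
      rcases hA _ _ hyy with ⟨hd, ho⟩ | hd
      · have h1 := h.frontier y hy y' hx z hz hAxz hd ho
        have h2 := hpos (o y) y y' hyy
        linarith
      · exact absurd (hlayer y hy) (by omega)
    · rw [hc _ y hy, hc _ y' hy']
      exact h.opt y hy y' hy' hyy
  · intro a haI b hb e heI hbe hd ho
    have hbS : b ∉ S := fun hb' => hb (Finset.mem_insert_of_mem hb')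
    have hp := hpos (o a) b e hbe
    rcases Finset.mem_insert.1 haI with rfl | ha <;> rcases Finset.mem_insert.1 heI with rfl | he
    · linarith
    · simp only [Function.update_self, hc _ e he]
      have := hkey b e hbS he hbe (hd.trans hdx)
      rwa [ho] at this
    · simp only [Function.update_self, hc _ a ha]
      rcases hA _ _ hbe with ⟨hd', ho'⟩ | hd'
      · have := h.frontier a ha e hx z hz hAxz (hd'.trans hd) (ho'.trans ho)
        linarith
      · have := hlayer a ha
        omega
    · rw [hc _ a ha, hc _ e he]
      exact h.frontier a ha b hbS e he hbe hd ho
  · intro a ha b hb hd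
    have hle : d a ≤ d x := by
      rcases Finset.mem_insert.1 ha with rfl | ha
      exacts [le_rfl, hlayer a ha]
    by_contra hbS
    have := hmin b (fun hb' => hbS (Finset.mem_insert_of_mem hb')) hb
    omega

/-- There is a policy defined on every position from which the target is reachable. -/
lemma exists_policyOn [Fintype V] {A : V → V → Prop} {o : V → ι} {d : V → ℕ}
    {l : ι → V → V → ℝ} {t : V} (hpos : ∀ i x y, A x y → 0 < l i x y)
    (hA : ∀ x y, A x y → (d y = d x ∧ o y = o x) ∨ d y < d x)
    (ht : ∀ y, ¬ A t y) (hd : d t = 0) :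
    ∃ S s c, PolicyOn A o d l t S s c ∧ ∀ x, Relation.ReflTransGen A x t → x ∈ S := by
  have hbase : PolicyOn A o d l t {t} id (fun _ _ => 0) := by
    constructor
    · simp
    · simp
    · intro x hx hne
      exact absurd (Finset.mem_singleton.1 hx) hne
    · intro x hx y _ hxy
      exact absurd (Finset.mem_singleton.1 hx ▸ hxy) (ht y)
    · intro x _ y _ z _ hyz _ _
      have := hpos (o x) y z hyz
      linarith
    · intro x hx y _ hlt
      rw [Finset.mem_singleton.1 hx] at hlt
      omega
  obtain ⟨S, hS, hmax⟩ := Finset.exists_max_image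
    (Finset.univ.filter fun S : Finset V => ∃ s c, PolicyOn A o d l t S s c) Finset.card
    ⟨{t}, by simpa using ⟨_, _, hbase⟩⟩
  simp only [Finset.mem_filter, Finset.mem_univ, true_and] at hS hmax
  obtain ⟨s, c, h⟩ := hS
  refine ⟨S, s, c, h, fun w hw => ?_⟩
  by_contra hwS
  obtain ⟨x, hx, s', c', h'⟩ := h.extend hpos hA hwS hw
  have := hmax _ ⟨s', c', h'⟩
  rw [Finset.card_insert_of_notMem hx] at this
  omega

end Policy

section ComponentDistance

variable {V : Type} {n : ℕ}

lemma sameComp_iff_of_edge {E : V → V → Prop} {owner : V → Fin n} (hsym : EdgeSymm E) {x y : V}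
    (hxy : E x y) : SameComp E owner x y ↔ ¬ Terminal E y ∧ owner y = owner x := by
  have hx : ¬ Terminal E x := fun h => h y hxy
  constructor
  · rintro (rfl | ⟨h, -⟩)
    · exact ⟨hx, rfl⟩
    · clear hxy
      induction h with
      | refl => exact ⟨hx, rfl⟩
      | tail _ hbc ih => exact ⟨hbc.2.2.1, hbc.2.2.2.symm.trans ih.2⟩
  · rintro ⟨hy, ho⟩
    exact Or.inr ⟨.single ⟨hxy, hx, hy, ho.symm⟩, .single ⟨hsym _ _ hxy hy, hy, hx, ho⟩⟩

/-- The number (`0` or `1`) of component changes along the edge `(x, y)`. -/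
noncomputable def compChange (E : V → V → Prop) (owner : V → Fin n) (x y : V) : ℕ :=
  if SameComp E owner x y then 0 else 1

/-- There is a walk from the given position to `t` with the given number of component changes. -/
inductive ChangeWalk (E : V → V → Prop) (owner : V → Fin n) (t : V) : V → ℕ → Prop
  | nil : ChangeWalk E owner t t 0
  | cons {x y : V} {k : ℕ} : E x y → ChangeWalk E owner t y k →
      ChangeWalk E owner t x (k + compChange E owner x y)

/-- The least number of component changes on a walk to `t`. -/
noncomputable def compDist (E : V → V → Prop) (owner : V → Fin n) (t x : V) : ℕ :=
  sInf {k | ChangeWalk E owner t x k}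

variable {E : V → V → Prop} {owner : V → Fin n} {t : V}

lemma changeWalk_compDist {x : V} (hx : Relation.ReflTransGen E x t) :
    ChangeWalk E owner t x (compDist E owner t x) := by
  refine Nat.sInf_mem (s := {k | ChangeWalk E owner t x k}) ?_
  induction hx using Relation.ReflTransGen.head_induction_on with
  | refl => exact ⟨0, .nil⟩
  | head hab _ ih =>
    obtain ⟨k, hk⟩ := ih
    exact ⟨_, .cons hab hk⟩

lemma compDist_le {x : V} {k : ℕ} (h : ChangeWalk E owner t x k) : compDist E owner t x ≤ k :=
  Nat.sInf_le h

lemma compDist_self : compDist E owner t t = 0 :=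
  Nat.le_zero.1 (compDist_le .nil)

lemma compDist_le_of_edge {x y : V} (hxy : E x y) (hy : Relation.ReflTransGen E y t) :
    compDist E owner t x ≤ compDist E owner t y + compChange E owner x y :=
  compDist_le (.cons hxy (changeWalk_compDist hy))

lemma compChange_le_one {x y : V} : compChange E owner x y ≤ 1 := by
  unfold compChange
  split_ifs <;> simp

lemma compChange_eq_zero_iff (hsym : EdgeSymm E) {x y : V} (hxy : E x y) :
    compChange E owner x y = 0 ↔ ¬ Terminal E y ∧ owner y = owner x := by
  rw [← sameComp_iff_of_edge hsym hxy]
  unfold compChange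
  split_ifs with h <;> simp [h]

/-- Adjacent nonterminal positions of one player are equally far from `t`. -/
lemma compDist_eq_of_owner_eq (hsym : EdgeSymm E) {x y : V} (hxy : E x y)
    (hyt : Relation.ReflTransGen E y t) (hy : ¬ Terminal E y) (ho : owner y = owner x) :
    compDist E owner t y = compDist E owner t x := by
  have hyx := hsym _ _ hxy hy
  have h1 := compDist_le_of_edge (owner := owner) hxy hyt
  have h2 := compDist_le_of_edge (owner := owner) hyx (hyt.head hxy)
  rw [(compChange_eq_zero_iff hsym hxy).2 ⟨hy, ho⟩] at h1
  rw [(compChange_eq_zero_iff hsym hyx).2 ⟨fun h => h _ hxy, ho.symm⟩] at h2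
  omega

lemma compDist_pos (hsym : EdgeSymm E) (ht : Terminal E t) {x : V}
    (hx : Relation.ReflTransGen E x t) (hne : x ≠ t) : 0 < compDist E owner t x := by
  have key : ∀ {x k}, ChangeWalk E owner t x k → x ≠ t → 0 < k := by
    intro x k h
    induction h with
    | nil => exact fun h => absurd rfl h
    | @cons x y k hxy _ ih =>
      intro _
      by_cases hy : y = t
      · have : compChange E owner x y ≠ 0 := fun h0 =>
          ((compChange_eq_zero_iff hsym hxy).1 h0).1 (hy ▸ ht)
        omega
      · have := ih hy
        omega
  exact key (changeWalk_compDist hx) hne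

/-- The edges that stay with the same player or decrease the component distance to `t`. -/
def ProgressEdge (E : V → V → Prop) (owner : V → Fin n) (t x y : V) : Prop :=
  E x y ∧ Relation.ReflTransGen E y t ∧
    ((¬ Terminal E y ∧ owner y = owner x) ∨ compDist E owner t y < compDist E owner t x)

lemma reflTransGen_progressEdge (hsym : EdgeSymm E) {x : V}
    (hx : Relation.ReflTransGen E x t) :
    Relation.ReflTransGen (ProgressEdge E owner t) x t := by
  have key : ∀ {x k}, ChangeWalk E owner t x k → Relation.ReflTransGen E x t ∧
      (k = compDist E owner t x → Relation.ReflTransGen (ProgressEdge E owner t) x t) := by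
    intro x k h
    induction h with
    | nil => exact ⟨.refl, fun _ => .refl⟩
    | @cons x y k hxy hy ih =>
      refine ⟨ih.1.head hxy, fun hk => ?_⟩
      have h1 := compDist_le_of_edge (owner := owner) hxy ih.1
      have h2 := compDist_le hy
      have hk' : k = compDist E owner t y := by omega
      refine (ih.2 hk').head ⟨hxy, ih.1, ?_⟩
      by_cases h0 : compChange E owner x y = 0
      · exact Or.inl ((compChange_eq_zero_iff hsym hxy).1 h0)
      · right
        omega
  exact (key (changeWalk_compDist hx)).2 rfl

lemma ProgressEdge.compDist_add (hsym : EdgeSymm E) {x y : V}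
    (h : ProgressEdge E owner t x y) :
    compDist E owner t y + compChange E owner x y = compDist E owner t x := by
  obtain ⟨hxy, hy, h⟩ := h
  have h1 := compDist_le_of_edge (owner := owner) hxy hy
  have h2 := compChange_le_one (E := E) (owner := owner) (x := x) (y := y)
  rcases h with ⟨hn, ho⟩ | h
  · rw [compDist_eq_of_owner_eq hsym hxy hy hn ho, (compChange_eq_zero_iff hsym hxy).2 ⟨hn, ho⟩,
      add_zero]
  · omega

lemma ProgressEdge.layer (hsym : EdgeSymm E) {x y : V} (h : ProgressEdge E owner t x y) :
    (compDist E owner t y = compDist E owner t x ∧ owner y = owner x) ∨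
      compDist E owner t y < compDist E owner t x := by
  obtain ⟨hxy, hy, ⟨hn, ho⟩ | h⟩ := h
  · exact Or.inl ⟨compDist_eq_of_owner_eq hsym hxy hy hn ho, ho⟩
  · exact Or.inr h

lemma qVal_eq_sum {a b : V} (P : DiPath E a b) :
    qVal E owner P = 1 + ∑ k ∈ Finset.range P.len, compChange E owner (P.f k) (P.f (k + 1)) := by
  unfold qVal compChange
  congr 1
  rw [Finset.sum_congr rfl (g := fun k => if ¬ SameComp E owner (P.f k) (P.f (k + 1)) then 1 else 0)
    (fun k _ => by split_ifs <;> simp_all), ← Finset.card_filter]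
  exact Nat.subtype_card _ (by simp)

/-- Positions reachable from a position that reaches the terminal `t` also reach `t`. -/
lemma reaches_of_edge (huniq : ∀ v, Terminal E v → v = t) (hsym : EdgeSymm E) {x y : V}
    (hxy : E x y) (hx : Relation.ReflTransGen E x t) : Relation.ReflTransGen E y t := by
  by_cases hy : Terminal E y
  · rw [huniq y hy]
  · exact hx.head (hsym _ _ hxy hy)

lemma one_add_compDist_le_qVal {a : V} (huniq : ∀ v, Terminal E v → v = t) (hsym : EdgeSymm E)
    (ha : Relation.ReflTransGen E a t) (Q : DiPath E a t) :
    1 + compDist E owner t a ≤ qVal E owner Q := by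
  have key : ∀ m ≤ Q.len, Relation.ReflTransGen E (Q.f m) t ∧ compDist E owner t a ≤
      compDist E owner t (Q.f m) +
        ∑ k ∈ Finset.range m, compChange E owner (Q.f k) (Q.f (k + 1)) := by
    intro m
    induction m with
    | zero =>
      intro _
      simp [Q.first, ha]
    | succ m ih =>
      intro hm
      obtain ⟨h1, h2⟩ := ih (by omega)
      have he := Q.step m hm
      have hr := reaches_of_edge huniq hsym he h1
      have := compDist_le_of_edge (owner := owner) he hr
      rw [Finset.sum_range_succ]
      exact ⟨hr, by omega⟩
  have := (key Q.len le_rfl).2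
  rw [Q.last, compDist_self] at this
  rw [qVal_eq_sum]
  omega

end ComponentDistance

section PolicyPath

variable {V : Type} {n : ℕ} {E : V → V → Prop} {owner : V → Fin n} {t : V}

/-- A path all of whose steps are progress edges has the least possible number of components. -/
lemma qVal_of_progress (hsym : EdgeSymm E) {a : V} (P : DiPath E a t)
    (hP : ∀ k < P.len, ProgressEdge E owner t (P.f k) (P.f (k + 1))) :
    qVal E owner P = 1 + compDist E owner t a := by
  have key : ∀ m ≤ P.len, compDist E owner t a = compDist E owner t (P.f m) +
      ∑ k ∈ Finset.range m, compChange E owner (P.f k) (P.f (k + 1)) := by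
    intro m
    induction m with
    | zero => simp [P.first]
    | succ m ih =>
      intro hm
      have h1 := ih (by omega)
      have h2 := (hP m hm).compDist_add hsym
      rw [Finset.sum_range_succ]
      omega
  rw [qVal_eq_sum, key P.len le_rfl, P.last, compDist_self, zero_add]

lemma pathLen_eq_of_telescoping {R : V → V → Prop} {a b : V} (P : DiPath R a b) {l : V → V → ℝ}
    {c : V → ℝ} (hP : ∀ k < P.len, c (P.f k) = l (P.f k) (P.f (k + 1)) + c (P.f (k + 1))) :
    pathLen l P = c a - c b := by
  unfold pathLen
  have h := Finset.sum_range_sub' (fun k => c (P.f k)) P.len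
  simp only [P.first, P.last] at h
  rw [← h]
  refine Finset.sum_congr rfl fun k hk => ?_
  linarith [hP k (Finset.mem_range.1 hk)]

/-- Following a map that decreases a real-valued cost outside `t` gives a path to `t`. -/
lemma exists_diPath_of_decreasing [Finite V] {R : V → V → Prop} {S : Finset V} {s : V → V}
    {c : V → ℝ} {a : V} (ha : a ∈ S)
    (hs : ∀ x ∈ S, x ≠ t → R x (s x) ∧ s x ∈ S ∧ c (s x) < c x) :
    ∃ P : DiPath R a t, ∀ k < P.len, P.f k ∈ S ∧ P.f k ≠ t ∧ P.f (k + 1) = s (P.f k) := by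
  have hstep : ∀ k, (∀ j < k, s^[j] a ≠ t) → s^[k] a ∈ S := by
    intro k
    induction k with
    | zero => exact fun _ => ha
    | succ k ih =>
      intro h
      rw [Function.iterate_succ_apply']
      exact (hs _ (ih fun j hj => h j (by omega)) (h k (by omega))).2.1
  have hdec : ∀ N, (∀ j < N, s^[j] a ≠ t) → ∀ k ≤ N, ∀ j < k, c (s^[k] a) < c (s^[j] a) := by
    intro N hN k
    induction k with
    | zero => intro _ j hj; omega
    | succ k ih =>
      intro hk j hj
      have h1 := (hs _ (hstep k fun j hj => hN j (by omega)) (hN k (by omega))).2.2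
      rw [← Function.iterate_succ_apply' s k a] at h1
      rcases Nat.lt_succ_iff_lt_or_eq.1 hj with hj | rfl
      · exact h1.trans (ih (by omega) j hj)
      · exact h1
  have hinj : ∀ N, (∀ j < N, s^[j] a ≠ t) → ∀ j k, j ≤ N → k ≤ N → s^[j] a = s^[k] a → j = k := by
    intro N hN j k hj hk hjk
    rcases lt_trichotomy j k with h | h | h
    · exact absurd (hdec N hN k hk j h) (by simp [hjk])
    · exact h
    · exact absurd (hdec N hN j hj k h) (by simp [hjk])
  have hex : ∃ N, s^[N] a = t := by
    by_contra! hcon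
    refine not_injective_infinite_finite (fun k : ℕ => s^[k] a) fun j k hjk => ?_
    exact hinj (max j k) (fun j _ => hcon j) j k (le_max_left _ _) (le_max_right _ _) hjk
  have hN : ∀ j < Nat.find hex, s^[j] a ≠ t := fun j hj => Nat.find_min hex hj
  refine ⟨⟨Nat.find hex, fun k => s^[k] a, rfl, Nat.find_spec hex, fun k hk => ?_,
    hinj _ hN⟩, fun k hk => ⟨hstep k fun j hj => hN j (hj.trans hk), hN k hk,
      Function.iterate_succ_apply' s k a⟩⟩
  rw [Function.iterate_succ_apply']
  exact (hs _ (hstep k fun j hj => hN j (hj.trans hk)) (hN k hk)).1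

/-- A progress path whose costs are optimal for player `i` at the positions of `i` is
`i`-special. -/
lemma iSpecial_of_progress (huniq : ∀ v, Terminal E v → v = t) (ht : Terminal E t)
    (hsym : EdgeSymm E) {l : Fin n → V → V → ℝ} (hpos : ∀ i u v, E u v → 0 < l i u v)
    {a : V} (ha : Relation.ReflTransGen E a t) (i : Fin n) {c : V → ℝ} (hct : c t = 0)
    (P : DiPath E a t)
    (hP : ∀ k < P.len, ProgressEdge E owner t (P.f k) (P.f (k + 1)) ∧
      c (P.f k) = l i (P.f k) (P.f (k + 1)) + c (P.f (k + 1)))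
    (hopt : ∀ x y, owner x = i → ProgressEdge E owner t x y → c x ≤ l i x y + c y) :
    ISpecial E owner l i P := by
  intro Q
  set D := compDist E owner t with hD
  have hmono : ∀ k ≤ P.len, ∀ j ≤ k, D (P.f k) ≤ D (P.f j) ∧ c (P.f k) ≤ c (P.f j) ∧
      (D (P.f k) = D (P.f j) → owner (P.f k) = owner (P.f j)) := by
    intro k
    induction k with
    | zero =>
      intro _ j hj
      obtain rfl : j = 0 := by omega
      simp
    | succ k ih =>
      intro hk j hj
      rcases Nat.le_succ_iff.1 hj with hj | rfl
      · obtain ⟨h1, h2, h3⟩ := ih (by omega) j hj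
        obtain ⟨hp, hc⟩ := hP k (by omega)
        have hl := hpos i _ _ hp.1
        have hly := hp.layer hsym
        rw [← hD] at hly
        refine ⟨?_, by linarith, ?_⟩
        · rcases hly with h | h <;> omega
        · intro he
          rcases hly with ⟨h, ho⟩ | h
          · exact ho.trans (h3 (by omega))
          · omega
      · simp
  have honP : ∀ k ≤ P.len, ∀ j ≤ P.len, D (P.f j) = D (P.f k) → owner (P.f j) = owner (P.f k) := by
    intro k hk j hj h
    rcases le_total j k with hjk | hjk
    · exact ((hmono k hk j hjk).2.2 h.symm).symm
    · exact (hmono j hj k hjk).2.2 h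
  have hlater : ∀ k ≤ P.len, ∀ j ≤ P.len, D (P.f k) < D (P.f j) → c (P.f k) ≤ c (P.f j) := by
    intro k hk j hj h
    rcases le_total j k with hjk | hjk
    · exact (hmono k hk j hjk).2.1
    · have := (hmono j hj k hjk).1
      omega
  have hedge : ∀ k < Q.len, E (Q.f k) (Q.f (k + 1)) := by
    intro k hk
    rcases Q.step k hk with ⟨j, hj, h1, h2⟩ | h
    · rw [← h1, ← h2]
      exact P.step j hj
    · exact h.1
  have hreach : ∀ k ≤ Q.len, Relation.ReflTransGen E (Q.f k) t := by
    intro k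
    induction k with
    | zero => intro _; rwa [Q.first]
    | succ k ih => exact fun hk => reaches_of_edge huniq hsym (hedge k hk) (ih (by omega))
  have hmem : ∀ k ≤ Q.len, (∃ j ≤ P.len, P.f j = Q.f k) ∨
      (owner (Q.f k) = i ∧ ¬ Terminal E (Q.f k)) := by
    intro k hk
    rcases hk.lt_or_eq with hk | rfl
    · rcases Q.step k hk with ⟨j, hj, h1, -⟩ | h
      · exact Or.inl ⟨j, hj.le, h1⟩
      · exact Or.inr h.2
    · exact Or.inl ⟨P.len, le_rfl, by rw [P.last, Q.last]⟩
  have hlayer : ∀ k ≤ Q.len, ∃ j ≤ P.len, D (P.f j) = D (Q.f k) ∧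
      owner (P.f j) = owner (Q.f k) := by
    intro k
    induction k with
    | zero => exact fun _ => ⟨0, by omega, by rw [P.first, Q.first], by rw [P.first, Q.first]⟩
    | succ k ih =>
      intro hk
      rcases hmem (k + 1) hk with ⟨j, hj, he⟩ | ⟨ho, hn⟩
      · exact ⟨j, hj, by rw [he], by rw [he]⟩
      · rcases Q.step k hk with ⟨j, hj, -, he⟩ | ⟨-, ho', -⟩
        · exact ⟨j + 1, hj, by rw [he], by rw [he]⟩
        · obtain ⟨j, hj, h1, h2⟩ := ih (by omega)
          have := compDist_eq_of_owner_eq hsym (hedge k hk) (hreach _ hk) hn (ho.trans ho'.symm)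
          exact ⟨j, hj, h1.trans this.symm, by rw [h2, ho, ho']⟩
  have key : ∀ m ≤ Q.len,
      c (Q.f m) ≤ ∑ k ∈ Finset.Ico m Q.len, l i (Q.f k) (Q.f (k + 1)) ∨
      ∃ j ≤ P.len, D (Q.f m) < D (P.f j) ∧
        c (P.f j) ≤ ∑ k ∈ Finset.Ico m Q.len, l i (Q.f k) (Q.f (k + 1)) := by
    intro m hm
    induction hm using Nat.decreasingInduction with
    | self => left; simp [Q.last, hct]
    | of_succ m hm ih =>
      rw [Finset.sum_eq_sum_Ico_succ_bot hm]
      set T := ∑ k ∈ Finset.Ico (m + 1) Q.len, l i (Q.f k) (Q.f (k + 1))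
      have hl := hpos i _ _ (hedge m hm)
      rcases Q.step m hm with ⟨r, hr, h1, h2⟩ | ⟨he, ho, hn⟩
      · left
        have hc := (hP r hr).2
        rw [h1, h2] at hc
        rcases ih with ih | ⟨j, hj, hlt, hle⟩
        · linarith
        · have := hlater (r + 1) hr j hj (by rwa [h2])
          rw [h2] at this
          linarith
      · rcases hmem (m + 1) hm with ⟨r, hr, hrm⟩ | ⟨ho', hn'⟩
        · rcases lt_trichotomy (D (Q.f (m + 1))) (D (Q.f m)) with hlt | heq | hgt
          · left
            have := hopt _ _ ho ⟨he, hreach _ hm, Or.inr hlt⟩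
            rcases ih with ih | ⟨j, hj, hlt, hle⟩
            · linarith
            · rw [← hrm] at hlt this
              have := hlater r hr j hj hlt
              rw [← hrm] at hl ⊢
              linarith
          · have hnt : ¬ Terminal E (Q.f (m + 1)) := by
              intro h
              have h0 := huniq _ h
              have := compDist_pos (owner := owner) hsym ht (hreach m hm.le)
                (fun h => hn (by rwa [h]))
              rw [h0, hD, compDist_self] at heq
              omega
            obtain ⟨j, hj, h1, h2⟩ := hlayer m hm.le
            have ho' : owner (Q.f (m + 1)) = owner (Q.f m) := by
              rw [← hrm, ← h2]
              exact honP j hj r hr (by rw [hrm, heq, h1])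
            have := hopt _ _ ho ⟨he, hreach _ hm, Or.inl ⟨hnt, ho'⟩⟩
            rcases ih with ih | ⟨j, hj, hlt, hle⟩
            · left; linarith
            · exact Or.inr ⟨j, hj, heq.symm.trans_lt hlt, by linarith⟩
          · right
            rcases ih with ih | ⟨j, hj, hlt, hle⟩
            · exact ⟨r, hr, by rw [hrm]; exact hgt, by rw [hrm]; linarith⟩
            · exact ⟨j, hj, hgt.trans hlt, by linarith⟩
        · have heq := compDist_eq_of_owner_eq hsym he (hreach _ hm) hn' (ho'.trans ho.symm)
          have := hopt _ _ ho ⟨he, hreach _ hm, Or.inl ⟨hn', ho'.trans ho.symm⟩⟩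
          rcases ih with ih | ⟨j, hj, hlt, hle⟩
          · left; linarith
          · exact Or.inr ⟨j, hj, heq.symm.trans_lt hlt, by linarith⟩
  rw [pathLen_eq_of_telescoping P (fun k hk => (hP k hk).2), hct, sub_zero]
  unfold pathLen
  rw [Finset.range_eq_Ico]
  rcases key 0 (by omega) with h | ⟨j, hj, hlt, -⟩
  · rwa [Q.first] at h
  · have := (hmono j hj 0 (by omega)).1
    rw [P.first] at this
    rw [Q.first] at hlt
    omega

end PolicyPath

/-- In an edge-symmetric positive `n`-person shortest path
game with a single terminal `vt` reachable from `v₀`, there exists a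
`v₀ → vt` path `P` such that (B) `q(P)` is minimal among all `v₀ → vt` paths
and (C) `P` is `i`-special for every player `i`. -/
theorem exists_special_path
    {V : Type} [Fintype V] {n : ℕ}
    (E : V → V → Prop) (owner : V → Fin n) (l : Fin n → V → V → ℝ)
    (v0 vt : V)
    (hvt : Terminal E vt)                 -- `vt` is a terminal
    (huniq : ∀ v, Terminal E v → v = vt)  -- all terminals are merged into `vt`
    (hv0 : ¬ Terminal E v0)               -- the initial position is not terminal
    (hsym : EdgeSymm E)                   -- the game is edge-symmetric
    (hpos : ∀ i u v, E u v → 0 < l i u v) -- all lengths are positive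
    (hreach : Relation.ReflTransGen E v0 vt)  -- `vt` is reachable from `v0`
    :
    ∃ P : DiPath E v0 vt,
      (∀ Q : DiPath E v0 vt, qVal E owner P ≤ qVal E owner Q) ∧
      (∀ i, ISpecial E owner l i P) := by
  have hA : ∀ x y, ProgressEdge E owner vt x y → _ := fun x y h => h.layer hsym
  obtain ⟨S, s, c, hpol, hS⟩ := exists_policyOn (l := l)
    (fun i x y (h : ProgressEdge E owner vt x y) => hpos i x y h.1) hA
    (fun y h => hvt y h.1) compDist_self
  have hmem : ∀ x, Relation.ReflTransGen E x vt → x ∈ S := fun x hx =>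
    hS x (reflTransGen_progressEdge hsym hx)
  obtain ⟨P, hP⟩ := exists_diPath_of_decreasing (R := E) (t := vt) (c := c (owner v0))
    (hmem v0 hreach) (fun x hx hne => by
      obtain ⟨h1, h2, h3⟩ := hpol.step x hx hne
      have := hpos (owner v0) _ _ h1.1
      exact ⟨h1.1, h2, by linarith [h3 (owner v0)]⟩)
  have hstep : ∀ k < P.len, ProgressEdge E owner vt (P.f k) (P.f (k + 1)) ∧
      ∀ i, c i (P.f k) = l i (P.f k) (P.f (k + 1)) + c i (P.f (k + 1)) := by
    intro k hk
    obtain ⟨h1, h2, h3⟩ := hP k hk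
    obtain ⟨h4, -, h5⟩ := hpol.step _ h1 h2
    rw [h3]
    exact ⟨h4, h5⟩
  refine ⟨P, fun Q => ?_, fun i => ?_⟩
  · rw [qVal_of_progress hsym P fun k hk => (hstep k hk).1]
    exact one_add_compDist_le_qVal huniq hsym hreach Q
  · refine iSpecial_of_progress huniq hvt hsym hpos hreach i (hpol.target_cost i) P
      (fun k hk => ⟨(hstep k hk).1, (hstep k hk).2 i⟩) ?_
    rintro x y rfl h
    exact hpol.opt x (hmem x (h.2.1.head h.1)) y (hmem y h.2.1) h
end

section
/- Let Γ=(G,𝓛) be a 2-person edge-symmetric terminal game satisfying condition (S1) that every edge between two distinct non-terminal vertices joins positions of different players. Let σ be a situation such that for one of the players i the strategy σᵢ is a uniform best response to the opponent's strategy σ^{-i}. If u∈V_j and v∈V_i are distinct positions with j≠i joined by edges of G, then 𝓛ⁱ(σ,v) ≤ 𝓛ⁱ(σ,u). -/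
open scoped Classical

section UniformDefs

variable {V : Type}

/-- `s` is a situation in which player `i`'s strategy is a uniform best
response to the opponents' strategies: no unilateral deviation of `i`
improves `i`'s cost from any initial position. -/
def UBR {n : ℕ} (E : V → V → Prop) (owner : V → Fin n) (L : Fin n → V → ℝ)
    (i : Fin n) (s : V → V) : Prop :=
  ∀ s', IsSituation E s' → Deviation E owner i s s' →
    ∀ v, tCost E (L i) s v ≤ tCost E (L i) s' v

/-- `s'` is obtained from `s` by a uniform best improvement of player `i`. -/
def UBI {n : ℕ} (E : V → V → Prop) (owner : V → Fin n) (L : Fin n → V → ℝ)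
    (i : Fin n) (s s' : V → V) : Prop :=
  IsSituation E s' ∧ Deviation E owner i s s' ∧ s' ≠ s ∧
  UBR E owner L i s' ∧
  ∀ v, owner v = i → ¬ Terminal E v →
    s' v = s v ∨ tCost E (L i) s' v < tCost E (L i) s v

/-- `s` is `i`-basic: every position `v` with a terminal out-neighbour `w`
either uses the terminal move, or every uniform best improvement of player `i`
gives the owner of `v` a strictly better value at `v` than that terminal. -/
def IBasic {n : ℕ} (E : V → V → Prop) (owner : V → Fin n) (L : Fin n → V → ℝ)
    (i : Fin n) (s : V → V) : Prop :=
  ∀ v w, E v w → Terminal E w →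
    s v = w ∨ ∀ s', UBI E owner L i s s' → tCost E (L (owner v)) s' v < L (owner v) w

/-- (S1): every edge between two distinct non-terminal vertices joins positions
of different players. -/
def CondS1 {n : ℕ} (E : V → V → Prop) (owner : V → Fin n) : Prop :=
  ∀ u v, E u v → u ≠ v → ¬ Terminal E u → ¬ Terminal E v → owner u ≠ owner v

/-- (S2): every position has at most one terminal out-neighbour. -/
def CondS2 (E : V → V → Prop) : Prop :=
  ∀ v w w', E v w → E v w' → Terminal E w → Terminal E w' → w = w'

/-- (S3): a terminal position is reachable from every position. -/
def CondS3 (E : V → V → Prop) : Prop :=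
  ∀ v : V, ∃ w, Terminal E w ∧ Relation.ReflTransGen E v w

/-- Uniform Nash equilibrium: a situation that is a Nash equilibrium for every
choice of the initial position. -/
def IsUNE {n : ℕ} (E : V → V → Prop) (owner : V → Fin n) (L : Fin n → V → ℝ)
    (s : V → V) : Prop :=
  IsSituation E s ∧ ∀ i s', IsSituation E s' → Deviation E owner i s s' →
    ∀ v, tCost E (L i) s v ≤ tCost E (L i) s' v

end UniformDefs

section PlayCost

variable {V : Type} {E : V → V → Prop}

theorem stopTime_of_terminal {s : V → V} {x : V} {k : ℕ} (hk : Terminal E (s^[k] x))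
    (hlt : ∀ m < k, ¬ Terminal E (s^[m] x)) : stopTime E s x = k :=
  le_antisymm (Nat.sInf_le hk) (le_of_not_gt fun h =>
    hlt _ h (Nat.sInf_mem (s := {k | Terminal E (s^[k] x)}) ⟨k, hk⟩))

theorem tCost_of_terminal (L : V → ℝ) {s : V → V} {x : V} {k : ℕ}
    (hk : Terminal E (s^[k] x)) (hlt : ∀ m < k, ¬ Terminal E (s^[m] x)) :
    tCost E L s x = L (s^[k] x) := by
  rw [tCost, if_pos ⟨k, hk⟩, playEnd, stopTime_of_terminal hk hlt]

theorem Reaches.exists_first {s : V → V} {x : V} (h : Reaches E s x) :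
    ∃ k, Terminal E (s^[k] x) ∧ ∀ m < k, ¬ Terminal E (s^[m] x) :=
  ⟨Nat.find h, Nat.find_spec h, fun _ => Nat.find_min h⟩

/-- The cost is unchanged by playing one move from a non-terminal position. -/
theorem tCost_apply (L : V → ℝ) (s : V → V) {x : V} (hx : ¬ Terminal E x) :
    tCost E L s (s x) = tCost E L s x := by
  by_cases h : Reaches E s (s x)
  · obtain ⟨k, hk, hlt⟩ := h.exists_first
    rw [tCost_of_terminal L hk hlt, tCost_of_terminal (k := k + 1) L hk]
    · rfl
    · rintro (_ | m) hm
      · exact hx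
      · exact hlt m (by omega)
  · have h' : ¬ Reaches E s x := by
      rintro ⟨_ | k, hk⟩
      · exact hx hk
      · exact h ⟨k, hk⟩
    rw [tCost, tCost, if_neg h, if_neg h']

/-- The cost is constant along a play until it stops. -/
theorem tCost_iterate (L : V → ℝ) (s : V → V) {x : V} {k : ℕ}
    (hlt : ∀ m < k, ¬ Terminal E (s^[m] x)) :
    tCost E L s (s^[k] x) = tCost E L s x := by
  induction k with
  | zero => rfl
  | succ k ih =>
    rw [Function.iterate_succ_apply', tCost_apply L s (hlt k k.lt_succ_self),
      ih fun m hm => hlt m (by omega)]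

/-- The cost depends only on the moves made at the non-terminal positions of the play. -/
theorem tCost_congr (L : V → ℝ) {s s' : V → V} {x : V}
    (h : ∀ k, (∀ m ≤ k, ¬ Terminal E (s^[m] x)) → s' (s^[k] x) = s (s^[k] x)) :
    tCost E L s' x = tCost E L s x := by
  have hiter : ∀ k, (∀ m < k, ¬ Terminal E (s^[m] x)) → s'^[k] x = s^[k] x := by
    intro k
    induction k with
    | zero => intro _; rfl
    | succ k ih =>
      intro hk
      rw [Function.iterate_succ_apply', Function.iterate_succ_apply',
        ih fun m hm => hk m (by omega), h k fun m hm => hk m (by omega)]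
  by_cases hr : Reaches E s x
  · obtain ⟨k, hk, hlt⟩ := hr.exists_first
    rw [tCost_of_terminal L hk hlt, ← hiter k hlt]
    refine tCost_of_terminal L (by rwa [hiter k hlt]) fun m hm => ?_
    rw [hiter m fun l hl => hlt l (by omega)]
    exact hlt m hm
  · have hn : ∀ k, ¬ Terminal E (s^[k] x) := fun k hk => hr ⟨k, hk⟩
    have hr' : ¬ Reaches E s' x := by
      rintro ⟨k, hk⟩
      exact hn k (by rwa [hiter k fun m _ => hn m] at hk)
    rw [tCost, tCost, if_neg hr, if_neg hr']

end PlayCost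

/-- In a 2-person edge-symmetric terminal game satisfying
(S1), if `σ` is a situation in which player `i`'s strategy is a uniform best
response to the opponent, and `u ∈ V_j`, `v ∈ V_i` are distinct positions with
`j ≠ i` joined by an edge, then `𝓛ⁱ(σ, v) ≤ 𝓛ⁱ(σ, u)`. -/
theorem uniformBestResponse_neighbor_ineq
    {V : Type} [Fintype V]
    (E : V → V → Prop) (owner : V → Fin 2) (L : Fin 2 → V → ℝ)
    (hT : ∃ v, Terminal E v)        -- the set of terminals is nonempty
    (hsym : EdgeSymm E)             -- the game is edge-symmetric
    (hS1 : CondS1 E owner)          -- condition (S1)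
    (s : V → V) (hs : IsSituation E s)
    (i : Fin 2) (hbr : UBR E owner L i s)  -- `σᵢ` is a uniform best response
    (u v : V) (huv : u ≠ v)
    (hu : ¬ Terminal E u) (hv : ¬ Terminal E v)   -- `u`, `v` are positions of players
    (hou : owner u ≠ i)             -- `u ∈ V_j` with `j ≠ i`
    (hov : owner v = i)             -- `v ∈ V_i`
    (he : E u v)                    -- `u` and `v` are joined by edges of `G`
    :
    tCost E (L i) s v ≤ tCost E (L i) s u := by
  by_cases hvis : ∃ k, s^[k] u = v ∧ ∀ m < k, ¬ Terminal E (s^[m] u)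
  · obtain ⟨k, rfl, hlt⟩ := hvis
    exact (tCost_iterate (L i) s hlt).le
  · -- The play from `u` avoids `v`, so player `i` may redirect `v` to `u`.
    have hsit : IsSituation E (Function.update s v u) := by
      intro x hx
      rcases eq_or_ne x v with rfl | hxv
      · simpa using hsym u x he hv
      · simpa [hxv] using hs x hx
    have hdev : Deviation E owner i s (Function.update s v u) := by
      intro x hx
      refine Function.update_of_ne ?_ _ _
      rintro rfl
      exact hx.elim (fun h => h hov) hv
    refine (hbr _ hsit hdev v).trans_eq ?_
    rw [← tCost_apply (L i) _ hv, Function.update_self]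
    refine tCost_congr (L i) fun k hk => Function.update_of_ne ?_ _ _
    exact fun h => hvis ⟨k, h, fun m hm => hk m hm.le⟩
end

section
/- Let Γ=(G,𝓛) be an edge-symmetric terminal game satisfying conditions (S1), (S2) and (S3). Then there exists a situation σ that is i-basic for every player i∈I and for which the play P(σ,v) is finite (reaches a terminal) for every position v∈V. -/
open scoped Classical

/-- Some walk with `k` edges leads from a position to a terminal. -/
def ReachesTerminalIn {V : Type} (E : V → V → Prop) : ℕ → V → Prop
  | 0, v => Terminal E v
  | k + 1, v => ∃ u, E v u ∧ ReachesTerminalIn E k u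

/-- If a terminal is reachable from every position, the distance to the terminals
decreases along a suitable out-edge of each non-terminal position. -/
theorem exists_terminal_rank {V : Type} {E : V → V → Prop} (hS3 : CondS3 E) :
    ∃ d : V → ℕ, (∀ v, d v = 0 ↔ Terminal E v) ∧ (∀ u v, E u v → d u ≤ d v + 1) ∧
      ∀ v, ¬ Terminal E v → ∃ u, E v u ∧ d u < d v := by
  have hR : ∀ v, ∃ k, ReachesTerminalIn E k v := by
    intro v
    obtain ⟨w, hw, hvw⟩ := hS3 v
    induction hvw using Relation.ReflTransGen.head_induction_on with
    | refl => exact ⟨0, hw⟩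
    | head huv _ ih =>
      obtain ⟨k, hk⟩ := ih
      exact ⟨k + 1, _, huv, hk⟩
  have hmin : ∀ v, ∃ k, ReachesTerminalIn E k v ∧ ∀ m, ReachesTerminalIn E m v → k ≤ m :=
    fun v => ⟨Nat.find (hR v), Nat.find_spec (hR v), fun _ => Nat.find_min' (hR v)⟩
  choose d hd hle using hmin
  have hd0 : ∀ v, d v = 0 ↔ Terminal E v := fun v =>
    ⟨fun h => by simpa [h, ReachesTerminalIn] using hd v, fun h => Nat.le_zero.1 (hle v 0 h)⟩
  refine ⟨d, hd0, fun u v huv => hle u _ ⟨v, huv, hd v⟩, fun v hv => ?_⟩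
  have hspec := hd v
  cases hk : d v with
  | zero => exact absurd ((hd0 v).1 hk) hv
  | succ k =>
    rw [hk] at hspec
    obtain ⟨u, hvu, hu⟩ := hspec
    exact ⟨u, hvu, Nat.lt_succ_of_le (hle u k hu)⟩

/-- Every edge-symmetric terminal game satisfying the
simplifying conditions (S1), (S2) and (S3) admits a situation `σ` that is
`i`-basic for every player `i` and whose plays `P(σ, v)` are finite for every
position `v`. -/
theorem exists_basic_finite_situation
    {V : Type} [Fintype V] {n : ℕ}
    (E : V → V → Prop) (owner : V → Fin n) (L : Fin n → V → ℝ)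
    (hT : ∃ v, Terminal E v)        -- the set of terminals is nonempty
    (hsym : EdgeSymm E)             -- the game is edge-symmetric
    (hS1 : CondS1 E owner)          -- condition (S1)
    (hS2 : CondS2 E)                -- condition (S2)
    (hS3 : CondS3 E)                -- condition (S3)
    :
    ∃ s : V → V, IsSituation E s ∧ (∀ v, Reaches E s v) ∧
      ∀ i, IBasic E owner L i s := by
  obtain ⟨d, hd0, hd1, hd⟩ := exists_terminal_rank hS3
  choose! s hs hlt using hd
  refine ⟨s, hs, fun v => ?_, fun i v w hvw hw => Or.inl ?_⟩
  · induction hk : d v using Nat.strong_induction_on generalizing v with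
    | _ k ih =>
      by_cases hv : Terminal E v
      · exact ⟨0, hv⟩
      · obtain ⟨m, hm⟩ := ih (d (s v)) (hk ▸ hlt v hv) (s v) rfl
        exact ⟨m + 1, hm⟩
  · have hv : ¬ Terminal E v := fun h => h w hvw
    have h_le := hd1 v w hvw
    have h_lt := hlt v hv
    rw [(hd0 w).2 hw] at h_le
    exact hS2 v (s v) w (hs v hv) hvw ((hd0 _).1 (by omega)) hw
end

section
/- Let Γ=(G,𝓛) be a 2-person edge-symmetric terminal game satisfying condition (CIW) and the simplifying conditions (S1), (S2), (S3). Let σ be a 1-basic situation in which all plays P(σ,v) are finite, and let σ¹ be obtained from σ by a uniform best improvement of player 1. Then the situation σ¹ is 2-basic. -/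
open scoped Classical

section PlayCost

variable {V : Type} {E : V → V → Prop} {s : V → V} {v : V}

theorem reaches_of_terminal (hv : Terminal E v) : Reaches E s v := ⟨0, hv⟩

theorem reaches_iff_of_not_terminal (hv : ¬ Terminal E v) :
    Reaches E s v ↔ Reaches E s (s v) := by
  constructor
  · rintro ⟨_ | k, hk⟩
    · exact absurd hk hv
    · exact ⟨k, hk⟩
  · rintro ⟨k, hk⟩
    exact ⟨k + 1, hk⟩

/-- Induction along a finite play, from its terminal position backwards. -/
theorem Reaches.induction {P : V → Prop} (hterm : ∀ v, Terminal E v → P v)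
    (hstep : ∀ v, ¬ Terminal E v → P (s v) → P v) (h : Reaches E s v) : P v := by
  obtain ⟨k, hk⟩ := h
  induction k generalizing v with
  | zero => exact hterm v hk
  | succ k ih =>
    by_cases hv : Terminal E v
    · exact hterm v hv
    · exact hstep v hv (ih hk)

theorem stopTime_of_terminal_s12 (hv : Terminal E v) : stopTime E s v = 0 :=
  Nat.sInf_eq_zero.2 (Or.inl hv)

theorem stopTime_of_not_terminal (hv : ¬ Terminal E v) (h : Reaches E s v) :
    stopTime E s v = stopTime E s (s v) + 1 := by
  have hmem : Terminal E (s^[stopTime E s v] v) := Nat.sInf_mem h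
  have hmem' : Terminal E (s^[stopTime E s (s v)] (s v)) :=
    Nat.sInf_mem ((reaches_iff_of_not_terminal hv).1 h)
  apply le_antisymm
  · exact Nat.sInf_le hmem'
  · cases hk : stopTime E s v with
    | zero => rw [hk] at hmem; exact absurd hmem hv
    | succ k =>
      rw [hk] at hmem
      exact Nat.succ_le_succ (Nat.sInf_le hmem)

theorem tCost_of_terminal_s12 (L : V → ℝ) (hv : Terminal E v) : tCost E L s v = L v := by
  simp [tCost, playEnd, reaches_of_terminal hv, stopTime_of_terminal_s12 hv]

theorem tCost_of_not_terminal (L : V → ℝ) (hv : ¬ Terminal E v) :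
    tCost E L s v = tCost E L s (s v) := by
  by_cases h : Reaches E s v
  · have h' := (reaches_iff_of_not_terminal hv).1 h
    simp only [tCost, if_pos h, if_pos h', playEnd, stopTime_of_not_terminal hv h,
      Function.iterate_succ_apply]
  · have h' := mt (reaches_iff_of_not_terminal hv).2 h
    simp only [tCost, if_neg h, if_neg h']

theorem tCost_neg_iff_reaches {L : V → ℝ} (hL : ∀ w, Terminal E w → L w < 0) :
    tCost E L s v < 0 ↔ Reaches E s v := by
  refine ⟨fun h => ?_, fun h => ?_⟩
  · by_contra hn
    simp [tCost, hn] at h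
  · rw [tCost, if_pos h]
    exact hL _ (Nat.sInf_mem h)

theorem Deviation.symm {n : ℕ} {owner : V → Fin n} {i : Fin n} {s' : V → V}
    (h : Deviation E owner i s s') : Deviation E owner i s' s :=
  fun v hv => (h v hv).symm

/-- At a best response of player `i`, no move of `i` leads to a position that is strictly
better for `i`. -/
theorem UBR.tCost_le_of_edge {n : ℕ} {owner : V → Fin n} {L : Fin n → V → ℝ} {i : Fin n}
    (h : UBR E owner L i s) (hs : IsSituation E s) {x u : V} (hx : owner x = i)
    (hxu : E x u) (hu : Reaches E s u) : tCost E (L i) s x ≤ tCost E (L i) s u := by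
  have hxt : ¬ Terminal E x := fun ht => ht u hxu
  have hs' : IsSituation E (Function.update s x u) := by
    intro y hy
    by_cases hyx : y = x
    · subst hyx
      simpa using hxu
    · simpa [hyx] using hs y hy
  have hdev : Deviation E owner i s (Function.update s x u) := by
    intro y hy
    have hyx : y ≠ x := by
      rintro rfl
      exact hy.elim (fun hy => hy hx) hxt
    simp [hyx]
  have key : tCost E (L i) s u = tCost E (L i) s x ∨
      tCost E (L i) (Function.update s x u) u = tCost E (L i) s u := by
    refine Reaches.induction (P := fun y => tCost E (L i) s y = tCost E (L i) s x ∨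
      tCost E (L i) (Function.update s x u) y = tCost E (L i) s y) ?_ ?_ hu
    · intro y hy
      simp only [tCost_of_terminal_s12 _ hy, or_true]
    · intro y hy ih
      by_cases hyx : y = x
      · exact Or.inl (by rw [hyx])
      · simpa only [tCost_of_not_terminal (L i) hy, Function.update_of_ne hyx] using ih
  rcases key with key | key
  · exact key.ge
  · calc tCost E (L i) s x ≤ tCost E (L i) (Function.update s x u) x := h _ hs' hdev x
      _ = tCost E (L i) s u := by
        rw [tCost_of_not_terminal _ hxt, Function.update_self, key]

/-- A best response of player `i` to a situation with finite plays has finite plays. -/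
theorem UBR.reaches {n : ℕ} {owner : V → Fin n} {L : Fin n → V → ℝ} {i : Fin n} {s' : V → V}
    (h : UBR E owner L i s') (hL : ∀ w, Terminal E w → L i w < 0)
    (hs : IsSituation E s) (hdev : Deviation E owner i s' s) (hv : Reaches E s v) :
    Reaches E s' v :=
  (tCost_neg_iff_reaches hL).1 ((h s hs hdev v).trans_lt ((tCost_neg_iff_reaches hL).2 hv))

end PlayCost

/-- In a 2-person edge-symmetric terminal game satisfying
(CIW), (S1), (S2), (S3): if `σ` is a `1`-basic situation in which all plays
are finite, and `σ¹` is obtained from `σ` by a uniform best improvement of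
player 1, then `σ¹` is `2`-basic.
(Player 1 is `(0 : Fin 2)` and player 2 is `(1 : Fin 2)`.) -/
theorem improvement_preserves_basic
    {V : Type} [Fintype V]
    (E : V → V → Prop) (owner : V → Fin 2) (L : Fin 2 → V → ℝ)
    (hT : ∃ v, Terminal E v)        -- the set of terminals is nonempty
    (hsym : EdgeSymm E)             -- the game is edge-symmetric
    (hCIW : ∀ i w, Terminal E w → L i w < 0)  -- (CIW)
    (hS1 : CondS1 E owner) (hS2 : CondS2 E) (hS3 : CondS3 E)
    (s : V → V) (hs : IsSituation E s)
    (hbasic : IBasic E owner L 0 s)   -- `σ` is 1-basic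
    (hfin : ∀ v, Reaches E s v)       -- all plays of `σ` are finite
    (s1 : V → V) (h1 : UBI E owner L 0 s s1)   -- `σ¹`: best improvement of player 1
    :
    IBasic E owner L 1 s1 := by
  obtain ⟨hs1, hdev1, -, hubr1, himp1⟩ := id h1
  have hfin1 : ∀ v, Reaches E s1 v := fun v =>
    hubr1.reaches (hCIW 0) hs hdev1.symm (hfin v)
  have strict : ∀ v w, E v w → Terminal E w → s1 v ≠ w →
      tCost E (L (owner v)) s1 v < L (owner v) w := by
    intro v w hvw hw hne
    have hvt : ¬ Terminal E v := fun h => h w hvw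
    rcases hbasic v w hvw hw with hsv | hlt
    · have ho : owner v = 0 := by
        by_contra ho
        exact hne ((hdev1 v (Or.inl ho)).trans hsv)
      have h := (himp1 v ho hvt).resolve_left fun h => hne (h.trans hsv)
      rwa [tCost_of_not_terminal (s := s) _ hvt, hsv, tCost_of_terminal_s12 _ hw, ← ho] at h
    · exact hlt s1 h1
  intro v w hvw hw
  refine or_iff_not_imp_left.2 fun hne s2 h2 => ?_
  obtain ⟨hs2, hdev2, -, hubr2, -⟩ := h2
  have hle2 : ∀ y, tCost E (L 1) s2 y ≤ tCost E (L 1) s1 y := hubr2 s1 hs1 hdev2.symm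
  -- The value of player 1 under `s1` does not increase along the plays of `s2`.
  have hle1 : ∀ y, tCost E (L 0) s2 y ≤ tCost E (L 0) s1 y := by
    intro y
    refine Reaches.induction (P := fun y => tCost E (L 0) s2 y ≤ tCost E (L 0) s1 y) ?_ ?_
      (hubr2.reaches (hCIW 1) hs1 hdev2.symm (hfin1 y))
    · intro y hy
      simp only [tCost_of_terminal_s12 _ hy, le_refl]
    · intro y hy ih
      rw [tCost_of_not_terminal _ hy]
      refine ih.trans ?_
      by_cases heq : s2 y = s1 y
      · rw [heq, ← tCost_of_not_terminal _ hy]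
      have ho : owner y = 1 := by
        by_contra ho
        exact heq (hdev2 y (Or.inl ho))
      have hedge := hs2 y hy
      by_cases ht : Terminal E (s2 y)
      · have hlt := strict y (s2 y) hedge ht (Ne.symm heq)
        have hle := hle2 y
        rw [tCost_of_not_terminal _ hy, tCost_of_terminal_s12 _ ht] at hle
        rw [ho] at hlt
        exact absurd hle hlt.not_ge
      · by_cases hloop : s2 y = y
        · rw [hloop]
        · have ho' := hS1 y (s2 y) hedge (Ne.symm hloop) hy ht
          exact hubr1.tCost_le_of_edge hs1 (by omega) (hsym y _ hedge ht) (hfin1 y)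
  have hlt := strict v w hvw hw hne
  obtain ho | ho : owner v = 0 ∨ owner v = 1 := by omega
  · rw [ho] at hlt ⊢
    exact (hle1 v).trans_lt hlt
  · rw [ho] at hlt ⊢
    exact (hle2 v).trans_lt hlt
end
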